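/- Let A = D + A' be the self-adjoint band operator as above. Assume there exist C > 0, δ ∈ ℝ, κ > 0 with δ + κ > 0 and n₀ such that C^{-1}n^{δ+κ−1} ≤ d(n+1) − d(n) ≤ C n^{δ+κ−1} for n ≥ n₀, d(n+2) − 2d(n+1) + d(n) = O(n^{δ+κ−2}), a_l(n) = O(n^δ), and a_l(n+1) − a_l(n) = O(n^{δ−1}) for l = 1,…,m. Then λ_n(A) = d(n) + O(n^{δ−κ}) as n → ∞. -/

import Mathlib

open Filter

/- l²(ℕ*) is modeled as `lp (fun _ : ℕ => ℂ) 2` (index j ↔ paper index j+1;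
the paper's convention "a_l(j-l) = 0, x(j-l) = 0 for j ≤ l" becomes the
`if l ≤ j` guards below). -/

/-- the off-diagonal band operator `A'`. -/
noncomputable def offDiagOp (m : ℕ) (a : ℕ → ℕ → ℝ) (x : ℕ → ℂ) (j : ℕ) : ℂ :=
  ∑ l ∈ Finset.Icc 1 m, ((a l j : ℂ) * x (j + l) +
    if l ≤ j then (a l (j - l) : ℂ) * x (j - l) else 0)

/-- the full band operator `A = D + A'`. -/
noncomputable def bandOp (m : ℕ) (d : ℕ → ℝ) (a : ℕ → ℕ → ℝ) (x : ℕ → ℂ) (j : ℕ) : ℂ :=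
  (d j : ℂ) * x j + offDiagOp m a x j

/-- `lam` is the nondecreasing enumeration (with multiplicity) of the eigenvalues
of the self-adjoint operator `A = D + A'` with compact resolvent: there is an
orthonormal basis `(v n)` of `l²` with `A (v n) = lam n • v n` and `lam n → ∞`,
`lam` nondecreasing. -/
def IsEigenSystem (m : ℕ) (d : ℕ → ℝ) (a : ℕ → ℕ → ℝ)
    (lam : ℕ → ℝ) (v : ℕ → lp (fun _ : ℕ => ℂ) 2) : Prop :=
  Orthonormal ℂ v ∧
  (Submodule.span ℂ (Set.range v)).topologicalClosure = ⊤ ∧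
  Monotone lam ∧ Tendsto lam atTop atTop ∧
  ∀ n j, bandOp m d a ((v n : lp (fun _ : ℕ => ℂ) 2) : ∀ _ : ℕ, ℂ) j
    = (lam n : ℂ) * (v n : ∀ _ : ℕ, ℂ) j

/-- the standing assumptions on `A = D + A'`: the relative decay condition
(|a_l(j-l)|+|a_l(j)|)/d(j) → 0 ensuring self-adjointness, and d(n) → ∞
ensuring compactness of the resolvent. -/
def StandingAssumptions (m : ℕ) (d : ℕ → ℝ) (a : ℕ → ℕ → ℝ) : Prop :=
  (∀ l ∈ Finset.Icc 1 m, Tendsto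
    (fun j => ((if l ≤ j then |a l (j - l)| else 0) + |a l j|) / d j) atTop (nhds 0)) ∧
  Tendsto d atTop atTop

section Part1
noncomputable def br (j : ℤ) : ℝ := 1 + |(j : ℝ)|

lemma br_pos (j : ℤ) : 0 < br j := by unfold br; positivity
lemma br_one_le (j : ℤ) : 1 ≤ br j := by unfold br; linarith [abs_nonneg (j : ℝ)]
lemma br_nat (j : ℕ) : br (j : ℤ) = (j : ℝ) + 1 := by
  unfold br; rw [Int.cast_natCast, abs_of_nonneg (Nat.cast_nonneg j)]; ring

lemma br_sub (j k : ℤ) (L : ℕ) (h : |j - k| ≤ (L : ℤ)) : |br k - br j| ≤ L := by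
  unfold br
  have h1 : |(j : ℝ) - k| ≤ L := by exact_mod_cast h
  have := abs_abs_sub_abs_le_abs_sub (k : ℝ) (j : ℝ)
  rw [abs_sub_comm] at h1
  calc _ = |(|(k : ℝ)| - |(j : ℝ)|)| := by ring_nf
    _ ≤ _ := this
    _ ≤ _ := h1

lemma br_slow (j k : ℤ) (L : ℕ) (h : |j - k| ≤ (L : ℤ)) : br k ≤ (1 + L) * br j := by
  have h1 := (abs_le.1 (br_sub j k L h)).2
  have h2 := br_one_le j
  have : (0 : ℝ) ≤ L := Nat.cast_nonneg L
  nlinarith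

lemma slow_rpow (s t c σ : ℝ) (hs : 0 < s) (ht : 0 < t) (hc : 1 ≤ c) (h1 : t ≤ c * s) (h2 : s ≤ c * t) :
    t ^ σ ≤ c ^ |σ| * s ^ σ := by
  have hc0 : 0 < c := by linarith
  rcases le_total 0 σ with h | h
  · rw [abs_of_nonneg h, ← Real.mul_rpow hc0.le hs.le]
    exact Real.rpow_le_rpow ht.le h1 h
  · rw [abs_of_nonpos h]
    have h3 : (c * t) ^ σ ≤ s ^ σ := Real.rpow_le_rpow_of_nonpos hs h2 h
    rw [Real.mul_rpow hc0.le ht.le] at h3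
    calc t ^ σ = c ^ (-σ) * (c ^ σ * t ^ σ) := by
          rw [← mul_assoc, ← Real.rpow_add hc0]; simp
      _ ≤ _ := by gcongr

lemma br_slow_rpow (j k : ℤ) (L : ℕ) (h : |j - k| ≤ (L : ℤ)) (σ : ℝ) :
    br k ^ σ ≤ (1 + L : ℝ) ^ |σ| * br j ^ σ :=
  slow_rpow _ _ _ _ (br_pos j) (br_pos k) (by have : (0 : ℝ) ≤ L := Nat.cast_nonneg L
                                              linarith) (br_slow j k L h)
    (br_slow k j L (by rwa [abs_sub_comm]))

/-- differences of powers -/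
lemma br_diff_rpow (L : ℕ) (σ : ℝ) : ∃ C : ℝ, 0 < C ∧ ∀ j k : ℤ, |j - k| ≤ (L : ℤ) →
    |br k ^ σ - br j ^ σ| ≤ C * br j ^ (σ - 1) := by
  refine ⟨|σ| * (1 + L : ℝ) ^ |σ - 1| * L + 1, by positivity, fun j k h => ?_⟩
  have hL : (0 : ℝ) ≤ L := Nat.cast_nonneg L
  have hj := br_pos j
  have hk := br_pos k
  have key : ∀ x ∈ Set.uIcc (br j) (br k), ‖σ * x ^ (σ - 1)‖ ≤ |σ| * ((1 + L : ℝ) ^ |σ - 1| * br j ^ (σ - 1)) := by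
    intro x hx
    have hx0 : 0 < x := lt_of_lt_of_le (lt_min hj hk) hx.1
    rw [norm_mul, Real.norm_eq_abs, Real.norm_eq_abs, abs_of_nonneg (Real.rpow_nonneg hx0.le _)]
    gcongr
    have a1 := br_slow j k L h
    have a2 := br_slow k j L (by rwa [abs_sub_comm])
    apply slow_rpow _ _ _ _ hj hx0 (by linarith)
    · refine hx.2.trans (max_le ?_ a1); nlinarith
    · have := hx.1
      rcases min_le_iff.1 this with h' | h'
      · nlinarith
      · exact a2.trans (by gcongr)
  have := Convex.norm_image_sub_le_of_norm_hasDerivWithin_le (f := fun x : ℝ => x ^ σ)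
    (f' := fun x => σ * x ^ (σ - 1)) (s := Set.uIcc (br j) (br k)) (x := br j) (y := br k)
    (fun x hx => (Real.hasDerivAt_rpow_const (Or.inl (ne_of_gt (lt_of_lt_of_le (lt_min hj hk) hx.1)))).hasDerivWithinAt)
    key (convex_uIcc _ _) Set.left_mem_uIcc Set.right_mem_uIcc
  rw [Real.norm_eq_abs, Real.norm_eq_abs] at this
  refine this.trans ?_
  have h5 := br_sub j k L h
  have h6 : 0 ≤ br j ^ (σ - 1) := Real.rpow_nonneg hj.le _
  calc _ ≤ |σ| * ((1 + L : ℝ) ^ |σ - 1| * br j ^ (σ - 1)) * L := by gcongr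
    _ ≤ _ := by nlinarith

/-- O-bounds to global bounds -/
lemma bigO_global (f : ℕ → ℝ) (σ : ℝ) (h : f =O[atTop] fun n : ℕ => (n : ℝ) ^ σ) :
    ∃ K : ℝ, 0 < K ∧ ∀ n : ℕ, |f n| ≤ K * br (n : ℤ) ^ σ := by
  have h1 : (fun n : ℕ => (n : ℝ) ^ σ) =O[atTop] fun n : ℕ => br (n : ℤ) ^ σ := by
    apply Asymptotics.IsBigO.of_bound ((2 : ℝ) ^ |σ|)
    filter_upwards [eventually_ge_atTop 1] with n hn
    have hn' : (1 : ℝ) ≤ n := by exact_mod_cast hn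
    rw [Real.norm_eq_abs, Real.norm_eq_abs, abs_of_nonneg (by positivity),
      abs_of_nonneg (Real.rpow_nonneg (br_pos _).le _)]
    apply slow_rpow _ _ _ _ (br_pos _) (by linarith) (by norm_num) <;> rw [br_nat] <;> linarith
  obtain ⟨K, hK, hb⟩ := Asymptotics.bound_of_isBigO_nat_atTop (h.trans h1)
  refine ⟨K, hK, fun n => ?_⟩
  have := hb (x := n) (ne_of_gt (Real.rpow_pos_of_pos (br_pos _) _))
  rwa [Real.norm_eq_abs, Real.norm_eq_abs,  abs_of_nonneg (Real.rpow_nonneg (br_pos _).le _)] at this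

lemma bigO_of_global (f : ℕ → ℝ) (σ K : ℝ) (h : ∀ᶠ n : ℕ in atTop, |f n| ≤ K * br (n : ℤ) ^ σ) :
    f =O[atTop] fun n : ℕ => (n : ℝ) ^ σ := by
  have h1 : (fun n : ℕ => br (n : ℤ) ^ σ) =O[atTop] fun n : ℕ => (n : ℝ) ^ σ := by
    apply Asymptotics.IsBigO.of_bound ((2 : ℝ) ^ |σ|)
    filter_upwards [eventually_ge_atTop 1] with n hn
    have hn' : (1 : ℝ) ≤ n := by exact_mod_cast hn
    rw [Real.norm_eq_abs, Real.norm_eq_abs, abs_of_nonneg (Real.rpow_nonneg (br_pos _).le _),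
      abs_of_nonneg (Real.rpow_nonneg (Nat.cast_nonneg n) σ)]
    apply slow_rpow _ _ _ _ (by linarith) (br_pos _) (by norm_num) <;> rw [br_nat] <;> linarith
  refine Asymptotics.IsBigO.trans ?_ h1
  apply Asymptotics.IsBigO.of_bound K
  filter_upwards [h] with n hn
  rwa [Real.norm_eq_abs, Real.norm_eq_abs, abs_of_nonneg (Real.rpow_nonneg (br_pos (n : ℤ)).le σ)]

/-- quadratic form bound for banded kernels -/
lemma quad_bound (S : ℕ → ℕ → ℝ) (C σ : ℝ) (hC : 0 ≤ C) (L N : ℕ) (x : ℕ → ℝ)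
    (hx : ∀ j, 0 ≤ x j)
    (hS0 : ∀ j k : ℕ, j < N → k < N → (L : ℤ) < |(j : ℤ) - k| → S j k = 0)
    (hS : ∀ j k : ℕ, j < N → k < N → |S j k| ≤ C * br (j : ℤ) ^ σ) :
    ∑ j ∈ Finset.range N, ∑ k ∈ Finset.range N, |S j k| * (x j * x k)
      ≤ (C * (1 + (1 + L : ℝ) ^ |σ|) * (2 * L + 1)) * ∑ j ∈ Finset.range N, br (j : ℤ) ^ σ * x j ^ 2 := by
  classical
  have hw : ∀ j : ℕ, 0 ≤ br (j : ℤ) ^ σ := fun j => Real.rpow_nonneg (br_pos _).le _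
  set E : ℝ := (1 + L : ℝ) ^ |σ|
  have hE : 0 ≤ E := by positivity
  let I : ℕ → ℕ → ℝ := fun j k => if |(j : ℤ) - k| ≤ L then 1 else 0
  have hI0 : ∀ j k, 0 ≤ I j k := fun j k => by simp only [I]; split_ifs <;> norm_num
  have hsym : ∀ j k, I j k = I k j := fun j k => by simp only [I]; rw [abs_sub_comm]
  have hcount : ∀ j, ∑ k ∈ Finset.range N, I j k ≤ 2 * L + 1 := by
    intro j
    simp only [I]
    rw [← Finset.sum_filter, Finset.sum_const, nsmul_eq_mul, mul_one]
    have : ((Finset.range N).filter fun k : ℕ => |(j : ℤ) - k| ≤ L) ⊆ Finset.Icc (j - L) (j + L) := by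
      intro k hk
      simp only [Finset.mem_filter, abs_le] at hk
      simp only [Finset.mem_Icc]; omega
    have h2 := Finset.card_le_card this
    rw [Nat.card_Icc] at h2
    have h3 : ((Finset.range N).filter fun k : ℕ => |(j : ℤ) - k| ≤ L).card ≤ 2 * L + 1 := by omega
    exact_mod_cast h3
  have term : ∀ j k : ℕ, j < N → k < N → |S j k| * (x j * x k) ≤
      C * (I j k * (br (j : ℤ) ^ σ * x j ^ 2)) + C * E * (I k j * (br (k : ℤ) ^ σ * x k ^ 2)) := by
    intro j k hjN hkN
    rw [← hsym j k]
    by_cases hjk : |(j : ℤ) - k| ≤ L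
    · have : I j k = 1 := by simp only [I]; rw [if_pos hjk]
      rw [this, one_mul, one_mul]
      have hs : br (j : ℤ) ^ σ ≤ E * br (k : ℤ) ^ σ := br_slow_rpow _ _ L (by rwa [abs_sub_comm]) σ
      have h0 := hS j k hjN hkN
      have hw1 := hw j
      have h1 : x j * x k ≤ x j ^ 2 + x k ^ 2 := by nlinarith [sq_nonneg (x j - x k), sq_nonneg (x j), sq_nonneg (x k)]
      calc |S j k| * (x j * x k) ≤ (C * br (j : ℤ) ^ σ) * (x j ^ 2 + x k ^ 2) := by
            gcongr; exact mul_nonneg (hx j) (hx k)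
        _ = C * (br (j : ℤ) ^ σ * x j ^ 2) + C * br (j : ℤ) ^ σ * x k ^ 2 := by ring
        _ ≤ C * (br (j : ℤ) ^ σ * x j ^ 2) + C * (E * br (k : ℤ) ^ σ) * x k ^ 2 := by gcongr
        _ = _ := by ring
    · rw [hS0 j k hjN hkN (not_le.1 hjk)]
      have : I j k = 0 := by simp only [I]; rw [if_neg hjk]
      rw [this]; simp
  have hsum1 : ∑ j ∈ Finset.range N, ∑ k ∈ Finset.range N, I j k * (br (j : ℤ) ^ σ * x j ^ 2)
      ≤ (2 * L + 1) * ∑ j ∈ Finset.range N, br (j : ℤ) ^ σ * x j ^ 2 := by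
    rw [Finset.mul_sum]
    apply Finset.sum_le_sum; intro j _
    rw [← Finset.sum_mul]
    exact mul_le_mul_of_nonneg_right (hcount j) (mul_nonneg (hw j) (sq_nonneg _))
  calc _ ≤ ∑ j ∈ Finset.range N, ∑ k ∈ Finset.range N,
        (C * (I j k * (br (j : ℤ) ^ σ * x j ^ 2)) + C * E * (I k j * (br (k : ℤ) ^ σ * x k ^ 2))) :=
        Finset.sum_le_sum fun j hj => Finset.sum_le_sum fun k hk =>
          term j k (Finset.mem_range.1 hj) (Finset.mem_range.1 hk)
    _ = C * (∑ j ∈ Finset.range N, ∑ k ∈ Finset.range N, I j k * (br (j : ℤ) ^ σ * x j ^ 2)) +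
        C * E * (∑ j ∈ Finset.range N, ∑ k ∈ Finset.range N, I j k * (br (j : ℤ) ^ σ * x j ^ 2)) := by
        simp only [Finset.sum_add_distrib, ← Finset.mul_sum]
        congr 1
        rw [Finset.sum_comm]
    _ ≤ C * ((2 * L + 1) * ∑ j ∈ Finset.range N, br (j : ℤ) ^ σ * x j ^ 2) +
       C * E * ((2 * L + 1) * ∑ j ∈ Finset.range N, br (j : ℤ) ^ σ * x j ^ 2) := by gcongr
    _ = _ := by ring

end Part1

section Part2
section flow
open NormedSpace

lemma banach_flow {𝔸 : Type*} [NormedRing 𝔸] [NormedAlgebra ℝ 𝔸] [CompleteSpace 𝔸]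
    (G D A : 𝔸) (s : ℝ) :
    HasDerivAt (fun s : ℝ => exp (s • G) * (D + s • A) * exp (s • (-G)))
      (exp (s • G) * (G * (D + s • A) - (D + s • A) * G + A) * exp (s • (-G))) s := by
  have h1 := hasDerivAt_exp_smul_const (𝕂 := ℝ) G s
  have h2 := hasDerivAt_exp_smul_const' (𝕂 := ℝ) (-G) s
  have h3 : HasDerivAt (fun s : ℝ => D + s • A) A s := by
    have := ((hasDerivAt_id s).smul_const A).const_add D
    simpa using this
  have := (h1.mul h3).mul h2
  refine this.congr_deriv ?_
  simp only [Pi.mul_apply]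
  generalize exp (s • G) = X
  generalize exp (s • (-G)) = Y
  generalize D + s • A = T
  noncomm_ring

variable {n : Type*} [Fintype n] [DecidableEq n]

/-- quadratic form -/
noncomputable def qf (S : Matrix n n ℂ) (x : n → ℂ) : ℂ := star x ⬝ᵥ (S.mulVec x)

lemma qf_conj (S U : Matrix n n ℂ) (y : n → ℂ) :
    qf S (U.mulVec y) = qf (U.conjTranspose * S * U) y := by
  unfold qf
  rw [Matrix.star_mulVec, ← Matrix.dotProduct_mulVec, Matrix.mulVec_mulVec, Matrix.mulVec_mulVec,
    Matrix.mul_assoc]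

noncomputable def flowU (G : Matrix n n ℂ) (s : ℝ) : Matrix n n ℂ := exp (s • (-G))

lemma flowU_conj (G : Matrix n n ℂ) (hG : G.conjTranspose = -G) (s : ℝ) :
    (flowU G s).conjTranspose = exp (s • G) := by
  unfold flowU
  rw [← Matrix.exp_conjTranspose]
  congr 1
  rw [Matrix.conjTranspose_smul, Matrix.conjTranspose_neg, hG]
  simp

lemma flowU_zero (G : Matrix n n ℂ) : flowU G 0 = 1 := by
  simp [flowU]

lemma flowU_unit (G : Matrix n n ℂ) (hG : G.conjTranspose = -G) (s : ℝ) :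
    (flowU G s).conjTranspose * flowU G s = 1 := by
  rw [flowU_conj G hG, flowU, ← Matrix.exp_add_of_commute]
  · simp
  · simp

attribute [local instance] Matrix.linftyOpNormedRing Matrix.linftyOpNormedAlgebra

lemma flow_deriv (G D A : Matrix n n ℂ) (hG : G.conjTranspose = -G) (y : n → ℂ) (s : ℝ) :
    HasDerivAt (fun s : ℝ => qf (D + s • A) ((flowU G s).mulVec y))
      (qf (G * (D + s • A) - (D + s • A) * G + A) ((flowU G s).mulVec y)) s := by
  simp only [qf_conj, flowU_conj G hG]
  unfold flowU
  have h := banach_flow G D A s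
  let Lf : Matrix n n ℂ →ₗ[ℝ] ℂ :=
    { toFun := fun S => qf S y
      map_add' := fun S T => by simp [qf, Matrix.add_mulVec]
      map_smul' := fun c S => by simp [qf, Matrix.smul_mulVec] }
  have h2 := (LinearMap.toContinuousLinearMap Lf).hasFDerivAt.comp_hasDerivAt s h
  exact h2

lemma qf_diag (w : n → ℝ) (x : n → ℂ) :
    qf (Matrix.diagonal fun j => (w j : ℂ)) x = ((∑ j, w j * ‖x j‖ ^ 2 : ℝ) : ℂ) := by
  unfold qf
  rw [dotProduct]
  push_cast
  refine Finset.sum_congr rfl fun j _ => ?_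
  rw [Matrix.mulVec_diagonal, Pi.star_apply, RCLike.star_def, ← Complex.conj_mul']
  ring

theorem flow_weight (G : Matrix n n ℂ) (hG : G.conjTranspose = -G) (w : n → ℝ) (hw : ∀ j, 0 ≤ w j)
    (K : ℝ) (hK : 0 ≤ K) (hc : ∀ x : n → ℂ, ‖qf (G * (Matrix.diagonal fun j => (w j : ℂ)) -
      (Matrix.diagonal fun j => (w j : ℂ)) * G) x‖ ≤ K * ∑ j, w j * ‖x j‖ ^ 2)
    (y : n → ℂ) (s : ℝ) (hs : s ∈ Set.Icc (0 : ℝ) 1) :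
    ∑ j, w j * ‖(flowU G s).mulVec y j‖ ^ 2 ≤ Real.exp K * ∑ j, w j * ‖y j‖ ^ 2 := by
  set W : Matrix n n ℂ := Matrix.diagonal fun j => (w j : ℂ)
  have hnn : ∀ x : n → ℂ, 0 ≤ ∑ j, w j * ‖x j‖ ^ 2 := fun x =>
    Finset.sum_nonneg fun j _ => mul_nonneg (hw j) (sq_nonneg _)
  have hqn : ∀ x : n → ℂ, ‖qf W x‖ = ∑ j, w j * ‖x j‖ ^ 2 := fun x => by
    rw [qf_diag, Complex.norm_real, Real.norm_eq_abs, abs_of_nonneg (hnn x)]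
  have hd : ∀ t : ℝ, HasDerivAt (fun s : ℝ => qf W ((flowU G s).mulVec y))
      (qf (G * W - W * G) ((flowU G t).mulVec y)) t := fun t => by
    simpa using flow_deriv G W 0 hG y t
  have := norm_le_gronwallBound_of_norm_deriv_right_le (a := 0) (b := 1) (δ := ‖qf W y‖) (K := K) (ε := 0)
    (f := fun s : ℝ => qf W ((flowU G s).mulVec y))
    (fun t _ => (hd t).continuousAt.continuousWithinAt) (fun t _ => (hd t).hasDerivWithinAt)
    (by simp [flowU_zero]) (fun t _ => by rw [hqn, add_zero]; exact hc _) s hs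
  rw [gronwallBound_ε0, hqn, hqn, sub_zero, mul_comm] at this
  refine this.trans ?_
  have h1 : K * s ≤ K := by nlinarith [hs.2]
  have h2 := hnn y
  gcongr

theorem flow_main (G D A : Matrix n n ℂ) (hG : G.conjTranspose = -G) (w : n → ℝ) (hw : ∀ j, 0 ≤ w j)
    (K K₂ : ℝ) (hK : 0 ≤ K) (hK₂ : 0 ≤ K₂) (hc : ∀ x : n → ℂ, ‖qf (G * (Matrix.diagonal fun j => (w j : ℂ)) -
      (Matrix.diagonal fun j => (w j : ℂ)) * G) x‖ ≤ K * ∑ j, w j * ‖x j‖ ^ 2)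
    (hF : ∀ x : n → ℂ, ‖qf (G * D - D * G + A) x‖ ≤ K₂ * ∑ j, w j * ‖x j‖ ^ 2)
    (hA : ∀ x : n → ℂ, ‖qf (G * A - A * G) x‖ ≤ K₂ * ∑ j, w j * ‖x j‖ ^ 2)
    (y : n → ℂ) :
    ‖qf (D + A) ((flowU G 1).mulVec y) - qf D y‖ ≤ 2 * K₂ * Real.exp K * ∑ j, w j * ‖y j‖ ^ 2 := by
  have := norm_image_sub_le_of_norm_deriv_le_segment_01' (C := 2 * K₂ * Real.exp K * ∑ j, w j * ‖y j‖ ^ 2)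
    (fun s _ => (flow_deriv G D A hG y s).hasDerivWithinAt) (fun s hs => ?_)
  · simpa [flowU_zero] using this
  · set x := (flowU G s).mulVec y
    have hx := flow_weight G hG w hw K hK hc y s ⟨hs.1, hs.2.le⟩
    have e : qf (G * (D + s • A) - (D + s • A) * G + A) x =
        qf (G * D - D * G + A) x + (s : ℂ) * qf (G * A - A * G) x := by
      have : G * (D + s • A) - (D + s • A) * G + A = (G * D - D * G + A) + s • (G * A - A * G) := by
        rw [Matrix.mul_add, Matrix.add_mul, Matrix.mul_smul, Matrix.smul_mul, smul_sub]; abel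
      rw [this]
      simp [qf, Matrix.add_mulVec, Matrix.smul_mulVec]
    rw [e]
    have h0 : 0 ≤ ‖qf (G * A - A * G) x‖ := norm_nonneg _
    calc _ ≤ ‖qf (G * D - D * G + A) x‖ + ‖(s : ℂ) * qf (G * A - A * G) x‖ := norm_add_le _ _
      _ = ‖qf (G * D - D * G + A) x‖ + s * ‖qf (G * A - A * G) x‖ := by
          rw [norm_mul, Complex.norm_real, Real.norm_eq_abs, abs_of_nonneg hs.1]
      _ ≤ ‖qf (G * D - D * G + A) x‖ + 1 * ‖qf (G * A - A * G) x‖ := by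
          gcongr; exact hs.2.le
      _ ≤ 2 * K₂ * ∑ j, w j * ‖x j‖ ^ 2 := by linarith [hF x, hA x]
      _ ≤ 2 * K₂ * (Real.exp K * ∑ j, w j * ‖y j‖ ^ 2) := by gcongr
      _ = _ := by ring

end flow

end Part2

section Part3
/-- banded symbol class -/
def Sy (m : ℕ) (σ K : ℝ) (f : ℤ → ℤ → ℝ) : Prop :=
  (∀ j k, (m : ℤ) < |j - k| → f j k = 0) ∧ (∀ j k, |f j k| ≤ K * br j ^ σ) ∧
  (∀ j k, |f (j + 1) (k + 1) - f j k| ≤ K * br j ^ (σ - 1))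

noncomputable def bm (ε : ℝ) (c : ℕ → ℕ → ℝ) (j k : ℤ) : ℝ :=
  (if j < k then 1 else ε) * (if 0 ≤ min j k then c (j - k).natAbs (min j k).toNat else 0)

lemma bm_abs (ε : ℝ) (hε : |ε| = 1) (c : ℕ → ℕ → ℝ) (j k : ℤ) :
    |bm ε c j k| = if 0 ≤ min j k then |c (j - k).natAbs (min j k).toNat| else 0 := by
  unfold bm
  rw [abs_mul]
  have : |(if j < k then (1 : ℝ) else ε)| = 1 := by split_ifs <;> simp [hε]
  rw [this, one_mul]
  split_ifs <;> simp

lemma bm_zero (ε : ℝ) (c : ℕ → ℕ → ℝ) (m : ℕ) (hc : ∀ l, m < l → ∀ i, c l i = 0) (j k : ℤ)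
    (h : (m : ℤ) < |j - k|) : bm ε c j k = 0 := by
  unfold bm
  rw [hc (j - k).natAbs (by rw [lt_abs] at h; omega)]
  simp

lemma bm_sy (m : ℕ) (σ K ε : ℝ) (hK : 0 ≤ K) (hε : |ε| = 1) (c : ℕ → ℕ → ℝ)
    (hc0 : ∀ l, m < l → ∀ i, c l i = 0)
    (hc1 : ∀ l i, |c l i| ≤ K * br (i : ℤ) ^ σ)
    (hc2 : ∀ l i, |c l (i + 1) - c l i| ≤ K * br (i : ℤ) ^ (σ - 1)) :
    Sy m σ (K * ((1 + (m + 1 : ℕ) : ℝ) ^ |σ| + (1 + (m + 1 : ℕ) : ℝ) ^ |σ - 1|)) (bm ε c) := by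
  set E1 := (1 + (m + 1 : ℕ) : ℝ) ^ |σ| with hE1
  set E2 := (1 + (m + 1 : ℕ) : ℝ) ^ |σ - 1| with hE2
  have hE1p : 0 ≤ E1 := by positivity
  have hE2p : 0 ≤ E2 := by positivity
  have hw : ∀ (j : ℤ) (τ : ℝ), 0 ≤ br j ^ τ := fun j τ => Real.rpow_nonneg (br_pos _).le _
  refine ⟨bm_zero ε c m hc0, fun j k => ?_, fun j k => ?_⟩
  · by_cases hjk : (m : ℤ) < |j - k|
    · rw [bm_zero ε c m hc0 j k hjk, abs_zero]
      have := hw j σ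
      positivity
    · rw [bm_abs ε hε]
      split_ifs with h0
      · have h1 := hc1 (j - k).natAbs (min j k).toNat
        rw [Int.toNat_of_nonneg h0] at h1
        have h2 := br_slow_rpow j (min j k) (m + 1) (by push_cast; rw [abs_le]; rw [not_lt, abs_le] at hjk; omega) σ
        calc _ ≤ _ := h1
          _ ≤ K * (E1 * br j ^ σ) := by gcongr
          _ ≤ K * ((E1 + E2) * br j ^ σ) := by
              have := hw j σ
              gcongr; linarith
          _ = _ := by ring
      · have := hw j σ
        positivity
  · by_cases hjk : (m : ℤ) < |j - k|
    · rw [bm_zero ε c m hc0 j k hjk, bm_zero ε c m hc0 (j+1) (k+1) (by rwa [add_sub_add_right_eq_sub]), sub_zero, abs_zero]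
      have := hw j (σ - 1)
      positivity
    · have hmin : min (j + 1) (k + 1) = min j k + 1 := by omega
      have fin : K * (E2 * br j ^ (σ - 1)) ≤ K * (E1 + E2) * br j ^ (σ - 1) := by
        have := hw j (σ - 1)
        rw [mul_assoc]
        gcongr; linarith
      refine le_trans ?_ fin
      have h2 := br_slow_rpow j (min j k) (m + 1) (by push_cast; rw [abs_le]; rw [not_lt, abs_le] at hjk; omega) (σ - 1)
      rcases lt_trichotomy (min j k) (-1) with h | h | h
      · have e1 : bm ε c j k = 0 := by unfold bm; rw [if_neg (by omega : ¬ 0 ≤ min j k), mul_zero]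
        have e2 : bm ε c (j+1) (k+1) = 0 := by
          unfold bm; rw [if_neg (by omega : ¬ 0 ≤ min (j+1) (k+1)), mul_zero]
        rw [e1, e2, sub_zero, abs_zero]
        have := hw j (σ - 1)
        positivity
      · have e1 : bm ε c j k = 0 := by unfold bm; rw [if_neg (by omega : ¬ 0 ≤ min j k), mul_zero]
        rw [e1, sub_zero, bm_abs ε hε, if_pos (by omega), hmin, h]
        have h1 := hc1 (j + 1 - (k + 1)).natAbs 0
        have h3 := br_slow_rpow j 0 (m + 1) (by push_cast; rw [abs_le]; rw [not_lt, abs_le] at hjk; omega) (σ - 1)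
        have hb0 : br 0 = 1 := by simp [br]
        simp only [Nat.cast_zero, hb0, Real.one_rpow] at h1 h3
        simp only [neg_add_cancel, Int.toNat_zero]
        refine h1.trans ?_
        gcongr
      · have h0 : 0 ≤ min j k := by omega
        have h1 := hc2 (j - k).natAbs (min j k).toNat
        rw [Int.toNat_of_nonneg h0] at h1
        have : bm ε c (j + 1) (k + 1) - bm ε c j k = (if j < k then 1 else ε) *
            (c (j - k).natAbs ((min j k).toNat + 1) - c (j - k).natAbs (min j k).toNat) := by
          unfold bm
          rw [hmin, if_pos h0, if_pos (by omega : 0 ≤ min j k + 1), add_sub_add_right_eq_sub,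
            Int.toNat_add h0 (by norm_num)]
          simp only [add_lt_add_iff_right, Int.toNat_one]
          ring
        rw [this, abs_mul]
        have h7 : |(if j < k then (1 : ℝ) else ε)| = 1 := by split_ifs <;> simp [hε]
        rw [h7, one_mul]
        refine h1.trans ?_
        gcongr

lemma sy_shift (m : ℕ) (σ K : ℝ) (hK : 0 ≤ K) (L : ℕ) (f : ℤ → ℤ → ℝ) (hf : Sy m σ K f) (j k r : ℤ)
    (hr : |r| ≤ (L : ℤ)) :
    |f (j + r) (k + r) - f j k| ≤ (L * K * ((1 + L : ℝ) ^ |σ - 1|) ^ 2) * br j ^ (σ - 1) := by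
  set E := (1 + L : ℝ) ^ |σ - 1| with hE
  have hE1 : 1 ≤ E := Real.one_le_rpow (by have : (0 : ℝ) ≤ L := Nat.cast_nonneg L
                                           linarith) (abs_nonneg _)
  have hw : ∀ (j : ℤ) (τ : ℝ), 0 ≤ br j ^ τ := fun j τ => Real.rpow_nonneg (br_pos _).le _
  have key : ∀ (j k : ℤ) (n : ℕ), n ≤ L → |f (j + n) (k + n) - f j k| ≤ n * (K * E * br j ^ (σ - 1)) := by
    intro j k n
    induction n with
    | zero => intro _; simp
    | succ n ih =>
      intro hn
      have h1 := ih (by omega)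
      have h2 := hf.2.2 (j + n) (k + n)
      have h3 := br_slow_rpow j (j + n) L (by rw [abs_le]; omega) (σ - 1)
      have h4 : K * br (j + n) ^ (σ - 1) ≤ K * (E * br j ^ (σ - 1)) := by gcongr
      push_cast
      rw [← add_assoc, ← add_assoc]
      calc _ ≤ |f (j + n + 1) (k + n + 1) - f (j + n) (k + n)| + |f (j + n) (k + n) - f j k| :=
            abs_sub_le _ _ _
        _ ≤ _ := by linarith
  rcases le_total 0 r with h | h
  · obtain ⟨n, rfl⟩ := Int.eq_ofNat_of_zero_le h
    have hn : n ≤ L := by rw [abs_le] at hr; omega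
    refine (key j k n hn).trans ?_
    have hn' : (n : ℝ) ≤ L := by exact_mod_cast hn
    have := hw j (σ - 1)
    calc _ ≤ (L : ℝ) * (K * E * br j ^ (σ - 1)) := by gcongr
      _ ≤ (L : ℝ) * (K * E ^ 2 * br j ^ (σ - 1)) := by gcongr; nlinarith
      _ = _ := by ring
  · obtain ⟨n, hn0⟩ := Int.eq_ofNat_of_zero_le (neg_nonneg.2 h)
    have hr' : r = -(n : ℤ) := by omega
    subst hr'
    have hn : n ≤ L := by rw [abs_le] at hr; omega
    have h1 := key (j + -n) (k + -n) n hn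
    rw [neg_add_cancel_right, neg_add_cancel_right, abs_sub_comm] at h1
    refine h1.trans ?_
    have hn' : (n : ℝ) ≤ L := by exact_mod_cast hn
    have h3 := br_slow_rpow j (j + -n) L (by rw [abs_le]; omega) (σ - 1)
    have := hw j (σ - 1)
    have := hw (j + -n) (σ - 1)
    calc _ ≤ (L : ℝ) * (K * E * (E * br j ^ (σ - 1))) := by gcongr
      _ = _ := by ring

/-- commutator kernel -/
noncomputable def cmk (M : ℕ) (g h : ℤ → ℤ → ℝ) (j k : ℤ) : ℝ :=
  ∑ i ∈ Finset.Ico (0 : ℤ) M, (g j i * h i k - h j i * g i k)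

lemma cmk_zero (M m : ℕ) (g h : ℤ → ℤ → ℝ) (hg : ∀ j k, (m : ℤ) < |j - k| → g j k = 0)
    (hh : ∀ j k, (m : ℤ) < |j - k| → h j k = 0) (j k : ℤ) (hjk : (2 * m : ℤ) < |j - k|) :
    cmk M g h j k = 0 := by
  unfold cmk
  apply Finset.sum_eq_zero
  intro i _
  have : (m : ℤ) < |j - i| ∨ (m : ℤ) < |i - k| := by simp only [lt_abs] at *; omega
  rcases this with h1 | h1
  · rw [hg _ _ h1, hh _ _ h1]; ring
  · rw [hg _ _ h1, hh _ _ h1]; ring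

lemma cmk_bound (m : ℕ) (σ₁ σ₂ K₁ K₂ : ℝ) (hK₁ : 0 ≤ K₁) (hK₂ : 0 ≤ K₂) :
    ∃ C : ℝ, 0 ≤ C ∧ ∀ (M : ℕ) (g h : ℤ → ℤ → ℝ), Sy m σ₁ K₁ g → Sy m σ₂ K₂ h →
      (∀ j k, (j < 0 ∨ (M : ℤ) ≤ j ∨ k < 0 ∨ (M : ℤ) ≤ k) → g j k = 0) →
      (∀ j k, (j < 0 ∨ (M : ℤ) ≤ j ∨ k < 0 ∨ (M : ℤ) ≤ k) → h j k = 0) →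
      ∀ j k : ℤ, 0 ≤ j → j < M → 0 ≤ k → k < M → |cmk M g h j k| ≤ C * br j ^ (σ₁ + σ₂ - 1) := by
  classical
  set C1 := (m * K₁ * ((1 + m : ℝ) ^ |σ₁ - 1|) ^ 2)
  set C2 := (m * K₂ * ((1 + m : ℝ) ^ |σ₂ - 1|) ^ 2)
  have hC1 : 0 ≤ C1 := by positivity
  have hC2 : 0 ≤ C2 := by positivity
  refine ⟨(2 * m + 1) * (K₁ * C2 + K₂ * C1), by positivity, ?_⟩
  intro M g h hg hh gs hs j k hj0 hjM hk0 hkM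
  set T := Finset.Icc (j + k - 2 * M) (2 * M : ℤ) with hT
  have hsub : Finset.Ico (0 : ℤ) M ⊆ T := by
    intro i hi
    simp only [hT, Finset.mem_Ico, Finset.mem_Icc] at *
    omega
  have e1 : cmk M g h j k = ∑ i ∈ T, (g j i * h i k - g (j + k - i) k * h j (j + k - i)) := by
    unfold cmk
    rw [Finset.sum_sub_distrib, Finset.sum_sub_distrib]
    congr 1
    · apply Finset.sum_subset hsub
      intro i _ hi
      simp only [Finset.mem_Ico] at hi
      rw [gs j i (by omega), zero_mul]
    · have : ∑ i ∈ Finset.Ico (0 : ℤ) M, h j i * g i k = ∑ i ∈ T, h j i * g i k := by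
        apply Finset.sum_subset hsub
        intro i _ hi
        simp only [Finset.mem_Ico] at hi
        rw [hs j i (by omega), zero_mul]
      rw [this]
      refine Finset.sum_nbij' (fun i => j + k - i) (fun i => j + k - i) ?_ ?_ ?_ ?_ ?_
      · intro i hi; simp only [hT, Finset.mem_Icc] at *; omega
      · intro i hi; simp only [hT, Finset.mem_Icc] at *; omega
      · intro i _; simp
      · intro i _; simp
      · intro i _; simp only [sub_sub_cancel]; ring
  rw [e1]
  have hbj := br_pos j
  have hw : 0 ≤ br j ^ (σ₁ + σ₂ - 1) := Real.rpow_nonneg hbj.le _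
  have term : ∀ i ∈ T, |g j i * h i k - g (j + k - i) k * h j (j + k - i)| ≤
      if i ∈ Finset.Icc (j - m) (j + m) then (K₁ * C2 + K₂ * C1) * br j ^ (σ₁ + σ₂ - 1) else 0 := by
    intro i _
    split_ifs with hi
    · rw [Finset.mem_Icc] at hi
      by_cases hp : (m : ℤ) < |i - k|
      · rw [hh.1 i k hp, hh.1 j (j + k - i) (by rw [show j - (j + k - i) = i - k by ring]; exact hp)]
        simp only [mul_zero, sub_zero, abs_zero]
        positivity
      · have s1 := sy_shift m σ₂ K₂ hK₂ m h hh j (j + k - i) (i - j) (by rw [abs_le]; omega)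
        have s2 := sy_shift m σ₁ K₁ hK₁ m g hg j i (k - i) (by rw [abs_sub_comm]; omega)
        rw [show j + (i - j) = i by ring, show j + k - i + (i - j) = k by ring] at s1
        rw [show j + (k - i) = j + k - i by ring, show i + (k - i) = k by ring] at s2
        have b1 := hg.2.1 j i
        have b2 := hh.2.1 j (j + k - i)
        have p1 : br j ^ σ₁ * br j ^ (σ₂ - 1) = br j ^ (σ₁ + σ₂ - 1) := by
          rw [← Real.rpow_add hbj]; congr 1; ring
        have p2 : br j ^ σ₂ * br j ^ (σ₁ - 1) = br j ^ (σ₁ + σ₂ - 1) := by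
          rw [← Real.rpow_add hbj]; congr 1; ring
        have q1 := Real.rpow_nonneg hbj.le σ₁
        have q2 := Real.rpow_nonneg hbj.le σ₂
        have q3 := Real.rpow_nonneg hbj.le (σ₁ - 1)
        have q4 := Real.rpow_nonneg hbj.le (σ₂ - 1)
        calc _ = |g j i * (h i k - h j (j + k - i)) - h j (j + k - i) * (g (j + k - i) k - g j i)| := by
              congr 1; ring
          _ ≤ |g j i| * |h i k - h j (j + k - i)| + |h j (j + k - i)| * |g (j + k - i) k - g j i| := by
              rw [← abs_mul, ← abs_mul]; exact abs_sub _ _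
          _ ≤ (K₁ * br j ^ σ₁) * (C2 * br j ^ (σ₂ - 1)) + (K₂ * br j ^ σ₂) * (C1 * br j ^ (σ₁ - 1)) := by
              gcongr
          _ = K₁ * C2 * (br j ^ σ₁ * br j ^ (σ₂ - 1)) + K₂ * C1 * (br j ^ σ₂ * br j ^ (σ₁ - 1)) := by ring
          _ = _ := by rw [p1, p2]; ring
    · rw [Finset.mem_Icc] at hi
      have h1 : (m : ℤ) < |j - i| := by
        rw [lt_abs]; omega
      rw [hg.1 j i h1, hg.1 (j + k - i) k (by rw [show j + k - i - k = j - i by ring]; exact h1)]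
      simp
  refine (Finset.abs_sum_le_sum_abs _ _).trans ((Finset.sum_le_sum term).trans ?_)
  rw [← Finset.sum_filter, Finset.sum_const, nsmul_eq_mul, mul_assoc]
  have hcard : ((T.filter fun i => i ∈ Finset.Icc (j - m) (j + m)).card : ℝ) ≤ 2 * m + 1 := by
    have h1 : (T.filter fun i => i ∈ Finset.Icc (j - m) (j + m)).card ≤ (Finset.Icc (j - m) (j + m)).card := by
      apply Finset.card_le_card
      intro i hi
      exact (Finset.mem_filter.1 hi).2
    rw [Int.card_Icc] at h1
    have h2 : (T.filter fun i => i ∈ Finset.Icc (j - m) (j + m)).card ≤ 2 * m + 1 := by omega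
    exact_mod_cast h2
  gcongr

noncomputable def toM (M : ℕ) (f : ℤ → ℤ → ℝ) : Matrix (Fin M) (Fin M) ℂ :=
  Matrix.of fun j k => ((f (j : ℕ) (k : ℕ) : ℝ) : ℂ)

lemma sum_Ico_int (M : ℕ) (f : ℤ → ℝ) : ∑ i ∈ Finset.Ico (0 : ℤ) M, f i = ∑ i : Fin M, f ((i : ℕ) : ℤ) := by
  rw [← Finset.sum_range (fun i : ℕ => f (i : ℤ))]
  symm
  refine Finset.sum_nbij' (fun i : ℕ => (i : ℤ)) (fun i : ℤ => i.toNat) ?_ ?_ ?_ ?_ ?_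
  · intro i hi; simp at *; omega
  · intro i hi; simp at *; omega
  · intro i hi; simp
  · intro i hi; simp at *; omega
  · intro i hi; rfl

lemma toM_comm (M : ℕ) (g h : ℤ → ℤ → ℝ) :
    toM M g * toM M h - toM M h * toM M g = toM M (cmk M g h) := by
  ext j k
  simp only [toM, Matrix.sub_apply, Matrix.mul_apply, Matrix.of_apply, cmk]
  rw [sum_Ico_int M fun i => (g (j : ℕ) i * h i (k : ℕ) - h (j : ℕ) i * g i (k : ℕ))]
  push_cast
  rw [Finset.sum_sub_distrib]

lemma qf_toM_bound (M L : ℕ) (f : ℤ → ℤ → ℝ) (C σ : ℝ) (hC : 0 ≤ C)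
    (h0 : ∀ j k : ℤ, (L : ℤ) < |j - k| → f j k = 0)
    (h1 : ∀ j k : ℤ, 0 ≤ j → j < M → 0 ≤ k → k < M → |f j k| ≤ C * br j ^ σ) (x : Fin M → ℂ) :
    ‖qf (toM M f) x‖ ≤ (C * (1 + (1 + L : ℝ) ^ |σ|) * (2 * L + 1)) *
      ∑ j : Fin M, br (j : ℕ) ^ σ * ‖x j‖ ^ 2 := by
  let X : ℕ → ℂ := fun j => if h : j < M then x ⟨j, h⟩ else 0
  have hX : ∀ j : Fin M, X j = x j := fun j => by simp [X]
  have hq := quad_bound (fun j k => f j k) C σ hC L M (fun j => ‖X j‖) (fun _ => norm_nonneg _)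
    (fun j k _ _ h => h0 j k h) (fun j k hj hk => h1 j k (by omega) (by omega) (by omega) (by omega))
  simp only [Finset.sum_range, hX] at hq
  refine le_trans ?_ hq
  unfold qf dotProduct
  refine (norm_sum_le _ _).trans (Finset.sum_le_sum fun j _ => ?_)
  rw [Matrix.mulVec, dotProduct, Finset.mul_sum]
  refine (norm_sum_le _ _).trans (Finset.sum_le_sum fun k _ => le_of_eq ?_)
  simp only [toM, Matrix.of_apply, norm_mul, Pi.star_apply, norm_star, Complex.norm_real, Real.norm_eq_abs]
  ring

end Part3

section Part4
structure Hy (m n1 : ℕ) (d : ℕ → ℝ) (a : ℕ → ℕ → ℝ) (δ κ K c0 : ℝ) : Prop where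
  hK : 0 ≤ K
  hc0 : 0 < c0
  hκ : 0 < κ
  ha : ∀ l ∈ Finset.Icc 1 m, ∀ i : ℕ, |a l i| ≤ K * br (i : ℤ) ^ δ
  ha2 : ∀ l ∈ Finset.Icc 1 m, ∀ i : ℕ, |a l (i + 1) - a l i| ≤ K * br (i : ℤ) ^ (δ - 1)
  hd : ∀ i : ℕ, n1 ≤ i → c0 * br (i : ℤ) ^ (δ + κ - 1) ≤ d (i + 1) - d i
  hd2 : ∀ i : ℕ, |d (i + 2) - 2 * d (i + 1) + d i| ≤ K * br (i : ℤ) ^ (δ + κ - 2)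

noncomputable def chi (m M : ℕ) (i : ℕ) : ℝ := max 0 (1 - ((i : ℝ) + m) / M)

lemma chi_nonneg (m M i : ℕ) : 0 ≤ chi m M i := le_max_left _ _
lemma chi_le_one (m M i : ℕ) : chi m M i ≤ 1 := by
  unfold chi
  apply max_le (by norm_num)
  have : 0 ≤ ((i : ℝ) + m) / M := by positivity
  linarith
lemma one_sub_chi (m M i : ℕ) : 1 - chi m M i ≤ ((i : ℝ) + m) / M := by
  have : 1 - ((i : ℝ) + m) / M ≤ chi m M i := le_max_right _ _
  linarith
lemma chi_zero (m M i : ℕ) (hM : 0 < M) (h : M ≤ i + m) : chi m M i = 0 := by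
  unfold chi
  apply max_eq_left
  have hM' : (0 : ℝ) < M := by exact_mod_cast hM
  have : (1 : ℝ) ≤ ((i : ℝ) + m) / M := by
    rw [le_div_iff₀ hM']; rw [one_mul]; exact_mod_cast h
  linarith
lemma chi_diff (m M i : ℕ) (hM : 0 < M) : |chi m M (i + 1) - chi m M i| ≤ (br (i : ℤ))⁻¹ := by
  have hb := br_pos (i : ℤ)
  by_cases h : M ≤ i + m
  · rw [chi_zero m M i hM h, chi_zero m M (i + 1) hM (by omega)]; simp; exact hb.le
  · have hM' : (0 : ℝ) < M := by exact_mod_cast hM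
    have h1 : |chi m M (i + 1) - chi m M i| ≤ |(1 - (((i + 1 : ℕ) : ℝ) + m) / M) - (1 - ((i : ℝ) + m) / M)| := by
      unfold chi
      have := abs_max_sub_max_le_max (0 : ℝ) (1 - (((i + 1 : ℕ) : ℝ) + m) / M) 0 (1 - ((i : ℝ) + m) / M)
      simpa using this
    refine h1.trans ?_
    have : (1 - (((i + 1 : ℕ) : ℝ) + m) / M) - (1 - ((i : ℝ) + m) / M) = -(1 / M) := by
      push_cast; field_simp; ring
    rw [this, abs_neg, abs_of_pos (by positivity), one_div]
    apply inv_anti₀ hb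
    rw [br_nat]
    have : i + 1 ≤ M := by omega
    exact_mod_cast this

noncomputable def cf (m : ℕ) (a : ℕ → ℕ → ℝ) (M l i : ℕ) : ℝ :=
  if 1 ≤ l ∧ l ≤ m then chi m M i * a l i else 0

noncomputable def gc (m n1 : ℕ) (d : ℕ → ℝ) (a : ℕ → ℕ → ℝ) (M l i : ℕ) : ℝ :=
  if n1 ≤ i ∧ 1 ≤ l ∧ l ≤ m then - cf m a M l i / (d (i + l) - d i) else 0

variable {m n1 : ℕ} {d : ℕ → ℝ} {a : ℕ → ℕ → ℝ} {δ κ K c0 : ℝ}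

lemma brw (j : ℤ) (τ : ℝ) : 0 ≤ br j ^ τ := Real.rpow_nonneg (br_pos _).le _

lemma cf_bd (hy : Hy m n1 d a δ κ K c0) (M : ℕ) (l i : ℕ) :
    |cf m a M l i| ≤ K * br (i : ℤ) ^ δ := by
  have := hy.hK
  have := brw i δ
  unfold cf
  split_ifs with h
  · rw [abs_mul, abs_of_nonneg (chi_nonneg _ _ _)]
    have h1 := hy.ha l (Finset.mem_Icc.2 h) i
    have h2 := chi_le_one m M i
    have h3 := chi_nonneg m M i
    have h4 := abs_nonneg (a l i)
    nlinarith
  · simp; positivity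

lemma cf_df (hy : Hy m n1 d a δ κ K c0) (M : ℕ) (hM : 0 < M) (l i : ℕ) :
    |cf m a M l (i + 1) - cf m a M l i| ≤ (2 * K) * br (i : ℤ) ^ (δ - 1) := by
  have hK := hy.hK
  have hb := brw i (δ - 1)
  unfold cf
  split_ifs with h
  · have h1 := hy.ha l (Finset.mem_Icc.2 h) i
    have h2 := hy.ha2 l (Finset.mem_Icc.2 h) i
    have h3 := chi_le_one m M (i + 1)
    have h4 := chi_nonneg m M (i + 1)
    have h5 := chi_diff m M i hM
    have e : br (i : ℤ) ^ (δ - 1) = br (i : ℤ) ^ δ * (br (i : ℤ))⁻¹ := by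
      rw [Real.rpow_sub (br_pos _), Real.rpow_one]; rfl
    have hbi := br_pos (i : ℤ)
    calc _ = |chi m M (i + 1) * (a l (i + 1) - a l i) + (chi m M (i + 1) - chi m M i) * a l i| := by
          congr 1; ring
      _ ≤ chi m M (i + 1) * |a l (i + 1) - a l i| + |chi m M (i + 1) - chi m M i| * |a l i| := by
          refine (abs_add_le _ _).trans ?_
          rw [abs_mul, abs_mul, abs_of_nonneg h4]
      _ ≤ 1 * (K * br (i : ℤ) ^ (δ - 1)) + (br (i : ℤ))⁻¹ * (K * br (i : ℤ) ^ δ) := by gcongr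
      _ = _ := by rw [e]; ring
  · simp; positivity

lemma d_gap (hy : Hy m n1 d a δ κ K c0) (i l : ℕ) (hi : n1 ≤ i) (hl : 1 ≤ l) :
    c0 * br (i : ℤ) ^ (δ + κ - 1) ≤ d (i + l) - d i := by
  induction l, hl using Nat.le_induction with
  | base => exact hy.hd i hi
  | succ l _ ih =>
    have h1 := hy.hd (i + l) (by omega)
    have h2 : 0 ≤ c0 * br ((i + l : ℕ) : ℤ) ^ (δ + κ - 1) := mul_nonneg hy.hc0.le (brw _ _)
    rw [← add_assoc]
    linarith

lemma d_gap2 (hy : Hy m n1 d a δ κ K c0) (i l : ℕ) (hl : l ≤ m) :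
    |(d (i + 1 + l) - d (i + 1)) - (d (i + l) - d i)| ≤
      (m * K * (1 + m : ℝ) ^ |δ + κ - 2|) * br (i : ℤ) ^ (δ + κ - 2) := by
  have hK := hy.hK
  have key : ∀ l ≤ m, |(d (i + 1 + l) - d (i + 1)) - (d (i + l) - d i)| ≤
      l * (K * (1 + m : ℝ) ^ |δ + κ - 2| * br (i : ℤ) ^ (δ + κ - 2)) := by
    intro l
    induction l with
    | zero => intro _; simp
    | succ l ih =>
      intro hl
      have h1 := ih (by omega)
      have h2 := hy.hd2 (i + l)
      have h3 := br_slow_rpow (i : ℤ) ((i + l : ℕ) : ℤ) m (by push_cast; rw [abs_le]; omega) (δ + κ - 2)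
      have h4 : K * br ((i + l : ℕ) : ℤ) ^ (δ + κ - 2) ≤ K * ((1 + m : ℝ) ^ |δ + κ - 2| * br (i : ℤ) ^ (δ + κ - 2)) := by
        gcongr
      rw [show i + 1 + (l + 1) = i + l + 2 by ring, show i + (l + 1) = i + l + 1 by ring]
      rw [show i + 1 + l = i + l + 1 by ring] at h1
      push_cast
      calc _ = |(d (i + l + 2) - 2 * d (i + l + 1) + d (i + l)) + ((d (i + l + 1) - d (i + 1)) - (d (i + l) - d i))| := by
            congr 1; ring
        _ ≤ _ := abs_add_le _ _
        _ ≤ _ := by linarith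
  refine (key l hl).trans ?_
  have : (l : ℝ) ≤ m := by exact_mod_cast hl
  have := brw i (δ + κ - 2)
  calc _ ≤ (m : ℝ) * (K * (1 + m : ℝ) ^ |δ + κ - 2| * br (i : ℤ) ^ (δ + κ - 2)) := by gcongr
    _ = _ := by ring

lemma gc_bd (hy : Hy m n1 d a δ κ K c0) (M : ℕ) (l i : ℕ) :
    |gc m n1 d a M l i| ≤ (K / c0) * br (i : ℤ) ^ (1 - κ) := by
  have hK := hy.hK
  have hc0 := hy.hc0
  have hb := brw i (1 - κ)
  unfold gc
  split_ifs with h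
  · have h1 := d_gap hy i l h.1 h.2.1
    have hp : 0 < c0 * br (i : ℤ) ^ (δ + κ - 1) := mul_pos hc0 (Real.rpow_pos_of_pos (br_pos _) _)
    rw [abs_div, abs_neg, abs_of_pos (hp.trans_le h1)]
    have h2 := cf_bd hy M l i
    calc _ ≤ (K * br (i : ℤ) ^ δ) / (c0 * br (i : ℤ) ^ (δ + κ - 1)) := by
          have := brw i δ
          gcongr
      _ = K / c0 * (br (i : ℤ) ^ δ / br (i : ℤ) ^ (δ + κ - 1)) := by rw [mul_div_mul_comm]
      _ = _ := by rw [← Real.rpow_sub (br_pos _)]; congr 2; ring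
  · simp; positivity

lemma gc_df (hy : Hy m n1 d a δ κ K c0) : ∃ C : ℝ, 0 ≤ C ∧ ∀ (M : ℕ), 0 < M → ∀ (l i : ℕ),
    |gc m n1 d a M l (i + 1) - gc m n1 d a M l i| ≤ C * br (i : ℤ) ^ (1 - κ - 1) := by
  have hK := hy.hK
  have hc0 := hy.hc0
  set c1 := c0 / (2 : ℝ) ^ |δ + κ - 1| with hc1
  have hc1p : 0 < c1 := by positivity
  set K3 := m * K * (1 + m : ℝ) ^ |δ + κ - 2| with hK3
  have hK3p : 0 ≤ K3 := by positivity
  set Ca := 2 * K / c1 + K * K3 / c1 ^ 2 with hCa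
  have hCap : 0 ≤ Ca := by positivity
  set Cb := (K / c0) * ((2 : ℝ) ^ |1 - κ| * (n1 + 1)) with hCb
  have hCbp : 0 ≤ Cb := by positivity
  refine ⟨Ca + Cb, by positivity, fun M hM l i => ?_⟩
  have hb := br_pos (i : ℤ)
  have hw := brw i (1 - κ - 1)
  by_cases hl : 1 ≤ l ∧ l ≤ m
  swap
  · have e : ∀ i, gc m n1 d a M l i = 0 := fun i => by
      unfold gc; rw [if_neg]; tauto
    rw [e, e]; simp; positivity
  by_cases hi : n1 ≤ i
  · have e0 : gc m n1 d a M l i = - cf m a M l i / (d (i + l) - d i) := by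
      unfold gc; rw [if_pos ⟨hi, hl⟩]
    have e1 : gc m n1 d a M l (i + 1) = - cf m a M l (i + 1) / (d (i + 1 + l) - d (i + 1)) := by
      unfold gc; rw [if_pos ⟨by omega, hl⟩]
    rw [e0, e1]
    have g0 := d_gap hy i l hi hl.1
    have g1 := d_gap hy (i + 1) l (by omega) hl.1
    have g2 := d_gap2 hy i l hl.2
    have f0 := cf_bd hy M l i
    have f1 := cf_df hy M hM l i
    set u := d (i + l) - d i
    set u' := d (i + 1 + l) - d (i + 1)
    set f := cf m a M l i
    set f' := cf m a M l (i + 1)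
    set T := br (i : ℤ) ^ (δ + κ - 1) with hT
    have hTp : 0 < T := Real.rpow_pos_of_pos hb _
    have two1 : (1 : ℝ) ≤ (2 : ℝ) ^ |δ + κ - 1| := Real.one_le_rpow (by norm_num) (abs_nonneg _)
    have hu : c1 * T ≤ u := by
      refine le_trans ?_ g0
      have : c1 ≤ c0 := div_le_self hc0.le two1
      gcongr
    have hu' : c1 * T ≤ u' := by
      refine le_trans ?_ g1
      have := br_slow_rpow ((i + 1 : ℕ) : ℤ) (i : ℤ) 1 (by push_cast; rw [abs_le]; omega) (δ + κ - 1)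
      rw [hc1, div_mul_eq_mul_div, div_le_iff₀ (by positivity)]
      norm_num at this
      push_cast
      calc c0 * T ≤ c0 * (2 ^ |δ + κ - 1| * br (i + 1) ^ (δ + κ - 1)) := by gcongr
        _ = _ := by ring
    have hup : 0 < u := lt_of_lt_of_le (by positivity) hu
    have hup' : 0 < u' := lt_of_lt_of_le (by positivity) hu'
    have id : -f' / u' - -f / u = -((f' - f) / u') + f * (u' - u) / (u * u') := by
      field_simp; ring
    rw [id]
    have p1 : br (i : ℤ) ^ (δ - 1) / T = br (i : ℤ) ^ (1 - κ - 1) := by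
      rw [hT, ← Real.rpow_sub hb]; congr 1; ring
    have p2 : br (i : ℤ) ^ δ * br (i : ℤ) ^ (δ + κ - 2) / (T * T) = br (i : ℤ) ^ (1 - κ - 1) := by
      rw [hT, ← Real.rpow_add hb, ← Real.rpow_add hb, ← Real.rpow_sub hb]; congr 1; ring
    have w1 := brw i δ
    have w2 := brw i (δ - 1)
    have w3 := brw i (δ + κ - 2)
    calc _ ≤ |f' - f| / u' + |f| * |u' - u| / (u * u') := by
          refine (abs_add_le _ _).trans (le_of_eq ?_)
          rw [abs_neg, abs_div, abs_div, abs_mul, abs_of_pos hup', abs_of_pos (mul_pos hup hup')]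
      _ ≤ (2 * K * br (i : ℤ) ^ (δ - 1)) / (c1 * T) +
          (K * br (i : ℤ) ^ δ) * (K3 * br (i : ℤ) ^ (δ + κ - 2)) / ((c1 * T) * (c1 * T)) := by gcongr
      _ = 2 * K / c1 * (br (i : ℤ) ^ (δ - 1) / T) +
          K * K3 / c1 ^ 2 * (br (i : ℤ) ^ δ * br (i : ℤ) ^ (δ + κ - 2) / (T * T)) := by
            field_simp
      _ = Ca * br (i : ℤ) ^ (1 - κ - 1) := by rw [p1, p2, hCa]; ring
      _ ≤ _ := by gcongr; linarith
  · have e0 : gc m n1 d a M l i = 0 := by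
      unfold gc; rw [if_neg]; tauto
    rw [e0, sub_zero]
    have h1 := gc_bd hy M l (i + 1)
    have h2 := br_slow_rpow (i : ℤ) ((i + 1 : ℕ) : ℤ) 1 (by push_cast; rw [abs_le]; omega) (1 - κ)
    have h3 : br (i : ℤ) ^ (1 - κ) ≤ (n1 + 1) * br (i : ℤ) ^ (1 - κ - 1) := by
      have : br (i : ℤ) ^ (1 - κ) = br (i : ℤ) * br (i : ℤ) ^ (1 - κ - 1) := by
        rw [Real.rpow_sub_one hb.ne']; field_simp
      rw [this]
      gcongr
      rw [br_nat]
      have : (i : ℝ) ≤ n1 := by exact_mod_cast (by omega : i ≤ n1)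
      linarith
    norm_num at h2
    push_cast at h1
    calc _ ≤ _ := h1
      _ ≤ K / c0 * (2 ^ |1 - κ| * ((n1 + 1) * br (i : ℤ) ^ (1 - κ - 1))) := by
        gcongr
        exact h2.trans (by gcongr)
      _ = Cb * br (i : ℤ) ^ (1 - κ - 1) := by rw [hCb]; ring
      _ ≤ _ := by gcongr; linarith

end Part4

section Part5
variable {m n1 : ℕ} {d : ℕ → ℝ} {a : ℕ → ℕ → ℝ} {δ κ K c0 : ℝ}

lemma bm_supp (ε : ℝ) (c : ℕ → ℕ → ℝ) (m M : ℕ) (hc0 : ∀ l, m < l → ∀ i, c l i = 0)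
    (hc : ∀ l i, M ≤ i + m → c l i = 0) (j k : ℤ)
    (h : j < 0 ∨ (M : ℤ) ≤ j ∨ k < 0 ∨ (M : ℤ) ≤ k) : bm ε c j k = 0 := by
  by_cases hl : (m : ℤ) < |j - k|
  · exact bm_zero ε c m hc0 j k hl
  · unfold bm
    split_ifs with h1 h2 h2
    · rw [hc _ _ (by rw [not_lt, abs_le] at hl; omega), mul_zero]
    · simp
    · rw [hc _ _ (by rw [not_lt, abs_le] at hl; omega), mul_zero]
    · simp

lemma cf_l (M : ℕ) : ∀ l, m < l → ∀ i, cf m a M l i = 0 := fun l hl i => by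
  unfold cf; rw [if_neg (by omega)]
lemma cf_s (M : ℕ) (hM : 0 < M) : ∀ l i, M ≤ i + m → cf m a M l i = 0 := fun l i h => by
  unfold cf; rw [chi_zero m M i hM h]; simp
lemma gc_l (M : ℕ) : ∀ l, m < l → ∀ i, gc m n1 d a M l i = 0 := fun l hl i => by
  unfold gc; rw [if_neg (by omega)]
lemma gc_s (M : ℕ) (hM : 0 < M) : ∀ l i, M ≤ i + m → gc m n1 d a M l i = 0 := fun l i h => by
  unfold gc; rw [cf_s M hM l i h]; simp

lemma bm_anti (c : ℕ → ℕ → ℝ) (h0 : ∀ i, c 0 i = 0) (j k : ℤ) : bm (-1) c k j = - bm (-1) c j k := by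
  unfold bm
  have e1 : (k - j).natAbs = (j - k).natAbs := by omega
  rw [min_comm k j, e1]
  rcases lt_trichotomy j k with h | h | h
  · rw [if_neg (by omega : ¬ k < j), if_pos h]; ring
  · subst h; simp [h0]
  · rw [if_neg (by omega : ¬ j < k), if_pos h]; ring

lemma bm_symm (c : ℕ → ℕ → ℝ) (j k : ℤ) : bm 1 c k j = bm 1 c j k := by
  unfold bm
  have e1 : (k - j).natAbs = (j - k).natAbs := by omega
  rw [min_comm k j, e1]
  simp

lemma toM_anti (M : ℕ) (g : ℤ → ℤ → ℝ) (h : ∀ j k, g k j = - g j k) :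
    (toM M g).conjTranspose = - toM M g := by
  ext j k
  simp only [toM, Matrix.conjTranspose_apply, Matrix.of_apply, Matrix.neg_apply]
  rw [h]; simp

lemma toM_diag (M : ℕ) (g : ℤ → ℤ → ℝ) (w : ℤ → ℝ) :
    toM M g * (Matrix.diagonal fun j : Fin M => ((w (j : ℕ) : ℝ) : ℂ)) -
      (Matrix.diagonal fun j : Fin M => ((w (j : ℕ) : ℝ) : ℂ)) * toM M g =
    toM M fun j k => g j k * (w k - w j) := by
  ext j k
  simp only [toM, Matrix.sub_apply, Matrix.mul_diagonal, Matrix.diagonal_mul, Matrix.of_apply]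
  push_cast; ring

lemma toM_add (M : ℕ) (g h : ℤ → ℤ → ℝ) : toM M g + toM M h = toM M fun j k => g j k + h j k := by
  ext j k
  simp [toM]

noncomputable def hk (m : ℕ) (a : ℕ → ℕ → ℝ) (M : ℕ) : ℤ → ℤ → ℝ := bm 1 (cf m a M)

lemma F_bound (hy : Hy m n1 d a δ κ K c0) : ∃ C : ℝ, 0 ≤ C ∧ ∀ M : ℕ, 0 < M → ∀ j k : ℤ, 0 ≤ j → 0 ≤ k →
    |bm (-1) (gc m n1 d a M) j k * (d k.toNat - d j.toNat) + hk m a M j k| ≤ C * br j ^ (δ - κ) := by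
  have hK := hy.hK
  set K' := (2 * K) * ((1 + (m + 1 : ℕ) : ℝ) ^ |δ| + (1 + (m + 1 : ℕ) : ℝ) ^ |δ - 1|)
  have hK' : 0 ≤ K' := by positivity
  refine ⟨K' * (1 + n1 + m : ℝ) ^ κ, by positivity, ?_⟩
  intro M hM j k hj hk0
  have hw := brw j (δ - κ)
  have sy : Sy m δ K' (hk m a M) := bm_sy m δ (2 * K) 1 (by positivity) (by simp) _ (cf_l M)
    (fun l i => (cf_bd hy M l i).trans (by have := brw i δ
                                           gcongr; linarith)) (fun l i => cf_df hy M hM l i)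
  by_cases hl : (m : ℤ) < |j - k|
  · rw [bm_zero _ _ m (gc_l M) j k hl, sy.1 j k hl]; simp; positivity
  by_cases hmin : (n1 : ℤ) ≤ min j k
  · -- exact cancellation
    have : bm (-1) (gc m n1 d a M) j k * (d k.toNat - d j.toNat) + hk m a M j k = 0 := by
      unfold hk bm
      have hm0 : 0 ≤ min j k := by omega
      rw [if_pos hm0, if_pos hm0]
      obtain ⟨p, rfl⟩ := Int.eq_ofNat_of_zero_le hj
      obtain ⟨q, rfl⟩ := Int.eq_ofNat_of_zero_le hk0
      rw [not_lt, abs_le] at hl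
      simp only [Int.toNat_natCast]
      rcases lt_trichotomy p q with h | h | h
      · have e1 : ((p : ℤ) - q).natAbs = q - p := by omega
        have e2 : (min (p : ℤ) q).toNat = p := by omega
        rw [e1, e2, if_pos (by omega), if_pos (by omega)]
        have g := d_gap hy p (q - p) (by omega) (by omega)
        have hp : 0 < c0 * br (p : ℤ) ^ (δ + κ - 1) := mul_pos hy.hc0 (Real.rpow_pos_of_pos (br_pos _) _)
        unfold gc
        rw [if_pos (by omega)]
        rw [show p + (q - p) = q by omega] at g ⊢
        have : d q - d p ≠ 0 := by linarith
        field_simp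
        ring
      · subst h
        have e1 : ((p : ℤ) - p).natAbs = 0 := by omega
        rw [e1]
        simp [cf]
      · have e1 : ((p : ℤ) - q).natAbs = p - q := by omega
        have e2 : (min (p : ℤ) q).toNat = q := by omega
        rw [e1, e2, if_neg (by omega), if_neg (by omega)]
        have g := d_gap hy q (p - q) (by omega) (by omega)
        have hp : 0 < c0 * br (q : ℤ) ^ (δ + κ - 1) := mul_pos hy.hc0 (Real.rpow_pos_of_pos (br_pos _) _)
        unfold gc
        rw [if_pos (by omega)]
        rw [show q + (p - q) = p by omega] at g ⊢
        have : d p - d q ≠ 0 := by linarith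
        field_simp
        ring
    rw [this]; simp; positivity
  · have : bm (-1) (gc m n1 d a M) j k = 0 := by
      unfold bm gc
      rw [if_neg (by omega : ¬ (n1 ≤ (min j k).toNat ∧ _))]
      simp
    rw [this, zero_mul, zero_add]
    refine (sy.2.1 j k).trans ?_
    have hb := br_pos j
    have e : br j ^ δ = br j ^ κ * br j ^ (δ - κ) := by
      rw [← Real.rpow_add hb]; congr 1; ring
    rw [e]
    have : br j ≤ 1 + n1 + m := by
      obtain ⟨p, rfl⟩ := Int.eq_ofNat_of_zero_le hj
      rw [not_lt, abs_le] at hl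
      rw [br_nat]
      have : p + 1 ≤ 1 + n1 + m := by omega
      exact_mod_cast this
    have h5 : br j ^ κ ≤ (1 + n1 + m : ℝ) ^ κ := Real.rpow_le_rpow hb.le this hy.hκ.le
    calc _ = K' * br j ^ κ * br j ^ (δ - κ) := by ring
      _ ≤ _ := by gcongr

theorem thmF (hy : Hy m n1 d a δ κ K c0) : ∃ C : ℝ, 0 ≤ C ∧ ∀ M : ℕ, 0 < M →
    ∃ U : Matrix (Fin M) (Fin M) ℂ, U.conjTranspose * U = 1 ∧
    (∀ y : Fin M → ℂ, ‖qf ((Matrix.diagonal fun j : Fin M => ((d j : ℝ) : ℂ)) + toM M (hk m a M)) (U.mulVec y)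
      - qf (Matrix.diagonal fun j : Fin M => ((d j : ℝ) : ℂ)) y‖ ≤
        C * ∑ j : Fin M, br (j : ℕ) ^ (δ - κ) * ‖y j‖ ^ 2) ∧
    (∀ y : Fin M → ℂ, ∑ j : Fin M, br (j : ℕ) ^ (δ + 1) * ‖U.mulVec y j‖ ^ 2 ≤
        C * ∑ j : Fin M, br (j : ℕ) ^ (δ + 1) * ‖y j‖ ^ 2) := by
  have hK := hy.hK
  have hc0 := hy.hc0
  set K1 := (2 * K) * ((1 + (m + 1 : ℕ) : ℝ) ^ |δ| + (1 + (m + 1 : ℕ) : ℝ) ^ |δ - 1|)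
  have hK1 : 0 ≤ K1 := by positivity
  obtain ⟨Cg, hCg, hgd⟩ := gc_df hy
  set K2 := (K / c0 + Cg) * ((1 + (m + 1 : ℕ) : ℝ) ^ |1 - κ| + (1 + (m + 1 : ℕ) : ℝ) ^ |1 - κ - 1|)
  have hK2 : 0 ≤ K2 := by positivity
  obtain ⟨CF, hCF, hF⟩ := F_bound hy
  obtain ⟨CA, hCA, hA⟩ := cmk_bound m (1 - κ) δ K2 K1 hK2 hK1
  -- weights
  have wt : ∀ σ : ℝ, ∃ Kw : ℝ, 0 ≤ Kw ∧ ∀ M : ℕ, 0 < M → ∀ x : Fin M → ℂ,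
      ‖qf (toM M (bm (-1) (gc m n1 d a M)) * (Matrix.diagonal fun j : Fin M => ((br (j : ℕ) ^ σ : ℝ) : ℂ)) -
      (Matrix.diagonal fun j : Fin M => ((br (j : ℕ) ^ σ : ℝ) : ℂ)) * toM M (bm (-1) (gc m n1 d a M))) x‖
       ≤ Kw * ∑ j : Fin M, br (j : ℕ) ^ σ * ‖x j‖ ^ 2 := by
    intro σ
    obtain ⟨Cd, hCd, hdiff⟩ := br_diff_rpow m σ
    refine ⟨((K2 * Cd) * (1 + (1 + m : ℝ) ^ |σ|) * (2 * m + 1)), by positivity, fun M hM x => ?_⟩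
    have sg : Sy m (1 - κ) K2 (bm (-1) (gc m n1 d a M)) :=
      bm_sy m (1 - κ) (K / c0 + Cg) (-1) (by positivity) (by simp) _ (gc_l M)
      (fun l i => (gc_bd hy M l i).trans (by have := brw i (1 - κ)
                                             gcongr; linarith))
      (fun l i => (hgd M hM l i).trans (by have := brw i (1 - κ - 1)
                                           gcongr
                                           have : 0 ≤ K / c0 := by positivity
                                           linarith))
    rw [toM_diag M _ (fun j => br j ^ σ)]
    apply qf_toM_bound M m _ (K2 * Cd) σ (by positivity)
    · intro j k hjk; rw [sg.1 j k hjk, zero_mul]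
    · intro j k _ _ _ _
      have hb := br_pos j
      by_cases hl : (m : ℤ) < |j - k|
      · rw [sg.1 j k hl]; have := brw j σ; simp; positivity
      · rw [abs_mul]
        have h1 := sg.2.1 j k
        have h2 := hdiff j k (not_lt.1 hl)
        have h3 : br j ^ (1 - κ) * br j ^ (σ - 1) ≤ br j ^ σ := by
          rw [← Real.rpow_add hb]
          apply Real.rpow_le_rpow_of_exponent_le (br_one_le j)
          linarith [hy.hκ]
        have := brw j (1 - κ)
        have := brw j (σ - 1)
        calc _ ≤ (K2 * br j ^ (1 - κ)) * (Cd * br j ^ (σ - 1)) := by gcongr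
          _ = K2 * Cd * (br j ^ (1 - κ) * br j ^ (σ - 1)) := by ring
          _ ≤ _ := by gcongr
  obtain ⟨Kw1, hKw1, hw1⟩ := wt (δ - κ)
  obtain ⟨Kw2, hKw2, hw2⟩ := wt (δ + 1)
  set KF := (CF * (1 + (1 + m : ℝ) ^ |δ - κ|) * (2 * m + 1))
  set KA := (CA * (1 + (1 + (2 * m : ℕ) : ℝ) ^ |δ - κ|) * (2 * (2 * m : ℕ) + 1))
  have hKF : 0 ≤ KF := by positivity
  have hKA : 0 ≤ KA := by positivity
  refine ⟨2 * (KF + KA) * Real.exp Kw1 + Real.exp Kw2, by positivity, fun M hM => ?_⟩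
  have sg : Sy m (1 - κ) K2 (bm (-1) (gc m n1 d a M)) :=
      bm_sy m (1 - κ) (K / c0 + Cg) (-1) (by positivity) (by simp) _ (gc_l M)
      (fun l i => (gc_bd hy M l i).trans (by have := brw i (1 - κ)
                                             gcongr; linarith))
      (fun l i => (hgd M hM l i).trans (by have := brw i (1 - κ - 1)
                                           gcongr
                                           have : 0 ≤ K / c0 := by positivity
                                           linarith))
  have sh : Sy m δ K1 (hk m a M) := bm_sy m δ (2 * K) 1 (by positivity) (by simp) _ (cf_l M)
    (fun l i => (cf_bd hy M l i).trans (by have := brw i δ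
                                           gcongr; linarith)) (fun l i => cf_df hy M hM l i)
  set G := toM M (bm (-1) (gc m n1 d a M)) with hGdef
  have hG : G.conjTranspose = -G := toM_anti M _ (bm_anti _ (fun i => by unfold gc; simp))
  have wnn : ∀ (σ : ℝ) (y : Fin M → ℂ), 0 ≤ ∑ j : Fin M, br (j : ℕ) ^ σ * ‖y j‖ ^ 2 := fun σ y =>
    Finset.sum_nonneg fun j _ => mul_nonneg (brw _ _) (sq_nonneg _)
  refine ⟨flowU G 1, flowU_unit G hG 1, fun y => ?_, fun y => ?_⟩
  · have := flow_main G (Matrix.diagonal fun j : Fin M => ((d j : ℝ) : ℂ)) (toM M (hk m a M)) hG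
      (fun j : Fin M => br (j : ℕ) ^ (δ - κ)) (fun j => brw _ _) Kw1 (KF + KA) hKw1 (by positivity)
      (hw1 M hM) ?_ ?_ y
    · refine this.trans ?_
      have := wnn (δ - κ) y
      gcongr
      have := Real.exp_pos Kw2
      linarith
    · intro x
      have e := toM_diag M (bm (-1) (gc m n1 d a M)) (fun j => d j.toNat)
      simp only [Int.toNat_natCast] at e
      rw [e, toM_add]
      refine (qf_toM_bound M m _ CF (δ - κ) hCF ?_ ?_ x).trans ?_
      · intro j k hjk; rw [sg.1 j k hjk, sh.1 j k hjk]; simp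
      · intro j k hj _ hk' _; exact hF M hM j k hj hk'
      · have := wnn (δ - κ) x
        gcongr
        linarith
    · intro x
      rw [hGdef, toM_comm]
      refine (qf_toM_bound M (2 * m) _ CA (δ - κ) hCA ?_ ?_ x).trans ?_
      · intro j k hjk; exact cmk_zero M m _ _ sg.1 sh.1 j k (by push_cast at hjk; exact hjk)
      · intro j k hj hj' hk' hk''
        have := hA M _ _ sg sh (bm_supp _ _ m M (gc_l M) (gc_s M hM)) (bm_supp _ _ m M (cf_l M) (cf_s M hM))
          j k hj hj' hk' hk''
        rwa [show 1 - κ + δ - 1 = δ - κ by ring] at this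
      · have := wnn (δ - κ) x
        gcongr
        linarith
  · have := flow_weight G hG (fun j : Fin M => br (j : ℕ) ^ (δ + 1)) (fun j => brw _ _) Kw2 hKw2
      (hw2 M hM) y 1 ⟨by norm_num, le_refl _⟩
    refine this.trans ?_
    have := wnn (δ + 1) y
    gcongr
    have : 0 ≤ 2 * (KF + KA) * Real.exp Kw1 := by positivity
    linarith

end Part5

section Part6
variable {m n1 : ℕ} {d : ℕ → ℝ} {a : ℕ → ℕ → ℝ} {δ κ K c0 : ℝ}

noncomputable def aK (m : ℕ) (a : ℕ → ℕ → ℝ) : ℤ → ℤ → ℝ :=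
  bm 1 (fun l i => if 1 ≤ l ∧ l ≤ m then a l i else 0)

lemma aK_zero (j k : ℤ) (h : (m : ℤ) < |j - k|) : aK m a j k = 0 :=
  bm_zero 1 _ m (fun l hl i => if_neg (by omega)) j k h

lemma aK_symm (j k : ℤ) : aK m a k j = aK m a j k := bm_symm _ j k

lemma aK_nat (j k : ℕ) : aK m a j k =
    if 1 ≤ ((j : ℤ) - k).natAbs ∧ ((j : ℤ) - k).natAbs ≤ m then a ((j : ℤ) - k).natAbs (min j k) else 0 := by
  unfold aK bm
  have h1 : (0 : ℤ) ≤ min (j : ℤ) k := by omega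
  have h2 : (min (j : ℤ) k).toNat = min j k := by omega
  rw [if_pos h1, h2]; simp

lemma hk_nat (M j k : ℕ) : hk m a M j k = chi m M (min j k) * aK m a j k := by
  rw [aK_nat]
  unfold hk bm cf
  have h1 : (0 : ℤ) ≤ min (j : ℤ) k := by omega
  have h2 : (min (j : ℤ) k).toNat = min j k := by omega
  rw [if_pos h1, h2]; simp

lemma offDiag_repr (x : ℕ → ℂ) (j N : ℕ) (hN : j + m < N) :
    offDiagOp m a x j = ∑ k ∈ Finset.range N, (aK m a j k : ℂ) * x k := by
  classical
  unfold offDiagOp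
  rw [Finset.sum_add_distrib]
  have s1 : ∑ l ∈ Finset.Icc 1 m, (a l j : ℂ) * x (j + l) =
      ∑ k ∈ Finset.range N, if j < k then (aK m a j k : ℂ) * x k else 0 := by
    rw [← Finset.sum_filter]
    have : ∑ k ∈ (Finset.range N).filter (fun k => j < k), (aK m a j k : ℂ) * x k =
        ∑ k ∈ Finset.Icc (j + 1) (j + m), (aK m a j k : ℂ) * x k := by
      symm
      apply Finset.sum_subset
      · intro k hk; simp only [Finset.mem_Icc, Finset.mem_filter, Finset.mem_range] at *; omega
      · intro k hk hk'
        simp only [Finset.mem_Icc, Finset.mem_filter, Finset.mem_range] at *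
        rw [aK_zero _ _ (by rw [lt_abs]; omega)]; simp
    rw [this]
    refine Finset.sum_nbij' (fun l => j + l) (fun k => k - j) ?_ ?_ ?_ ?_ ?_
    · intro l hl; simp only [Finset.mem_Icc] at *; omega
    · intro l hl; simp only [Finset.mem_Icc] at *; omega
    · intro l hl; simp
    · intro l hl; simp only [Finset.mem_Icc] at *; omega
    · intro l hl
      simp only [Finset.mem_Icc] at hl
      rw [aK_nat]
      have e1 : ((j : ℤ) - ((j + l : ℕ) : ℤ)).natAbs = l := by omega
      rw [e1, if_pos hl, min_eq_left (by omega)]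
  have s2 : ∑ l ∈ Finset.Icc 1 m, (if l ≤ j then (a l (j - l) : ℂ) * x (j - l) else 0) =
      ∑ k ∈ Finset.range N, if k < j then (aK m a j k : ℂ) * x k else 0 := by
    rw [← Finset.sum_filter, ← Finset.sum_filter]
    have : ∑ k ∈ (Finset.range N).filter (fun k => k < j), (aK m a j k : ℂ) * x k =
        ∑ k ∈ (Finset.range j).filter (fun k => j ≤ k + m), (aK m a j k : ℂ) * x k := by
      symm
      apply Finset.sum_subset
      · intro k hk; simp only [Finset.mem_filter, Finset.mem_range] at *; omega
      · intro k hk hk'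
        simp only [Finset.mem_filter, Finset.mem_range] at *
        rw [aK_zero _ _ (by rw [lt_abs]; omega)]; simp
    rw [this]
    refine Finset.sum_nbij' (fun l => j - l) (fun k => j - k) ?_ ?_ ?_ ?_ ?_
    · intro l hl; simp only [Finset.mem_Icc, Finset.mem_filter, Finset.mem_range] at *; omega
    · intro l hl; simp only [Finset.mem_Icc, Finset.mem_filter, Finset.mem_range] at *; omega
    · intro l hl; simp only [Finset.mem_Icc, Finset.mem_filter, Finset.mem_range] at *; omega
    · intro l hl; simp only [Finset.mem_Icc, Finset.mem_filter, Finset.mem_range] at *; omega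
    · intro l hl
      simp only [Finset.mem_Icc, Finset.mem_filter] at hl
      rw [aK_nat]
      have e1 : ((j : ℤ) - ((j - l : ℕ) : ℤ)).natAbs = l := by omega
      rw [e1, if_pos hl.1, min_eq_right (by omega)]
  rw [s1, s2, ← Finset.sum_add_distrib]
  refine Finset.sum_congr rfl fun k _ => ?_
  rcases lt_trichotomy j k with h | h | h
  · rw [if_pos h, if_neg (by omega), add_zero]
  · subst h; rw [aK_nat]; simp
  · rw [if_pos h, if_neg (by omega), zero_add]

lemma bandOp_supp (x : ℕ → ℂ) (M : ℕ) (hx : ∀ k, M ≤ k → x k = 0) (j : ℕ) :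
    bandOp m d a x j = (d j : ℂ) * x j + ∑ k ∈ Finset.range M, (aK m a j k : ℂ) * x k := by
  unfold bandOp
  rw [offDiag_repr x j (M + j + m + 1) (by omega)]
  congr 1
  symm
  apply Finset.sum_subset
  · intro k hk; simp only [Finset.mem_range] at *; omega
  · intro k hk hk'
    simp only [Finset.mem_range] at *
    rw [hx k (by omega), mul_zero]

lemma bandOp_supp_zero (x : ℕ → ℂ) (M : ℕ) (hx : ∀ k, M ≤ k → x k = 0) (j : ℕ) (hj : M + m ≤ j) :
    bandOp m d a x j = 0 := by
  rw [bandOp_supp x M hx, hx j (by omega), mul_zero, zero_add]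
  apply Finset.sum_eq_zero
  intro k hk
  simp only [Finset.mem_range] at hk
  rw [aK_zero _ _ (by rw [lt_abs]; omega)]; simp

lemma bandOp_symm (x v : ℕ → ℂ) (M : ℕ) (hx : ∀ k, M ≤ k → x k = 0) :
    ∑ j ∈ Finset.range (M + m), star (v j) * bandOp m d a x j =
    ∑ k ∈ Finset.range (M + m), star (bandOp m d a v k) * x k := by
  have e1 : ∀ j ∈ Finset.range (M + m), star (v j) * bandOp m d a x j = star (v j) * (d j * x j) +
      ∑ k ∈ Finset.range M, star (v j) * ((aK m a j k : ℂ) * x k) := fun j _ => by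
    rw [bandOp_supp x M hx, mul_add, Finset.mul_sum]
  have e2 : ∑ k ∈ Finset.range (M + m), star (bandOp m d a v k) * x k =
     ∑ k ∈ Finset.range (M + m), star (v k) * (d k * x k) +
       ∑ k ∈ Finset.range M, ∑ j ∈ Finset.range (M + m), star (v j) * ((aK m a j k : ℂ) * x k) := by
    have : ∑ k ∈ Finset.range M, ∑ j ∈ Finset.range (M + m), star (v j) * ((aK m a j k : ℂ) * x k) =
       ∑ k ∈ Finset.range (M + m), star (offDiagOp m a v k) * x k := by
      rw [← Finset.sum_subset (s₁ := Finset.range M) (s₂ := Finset.range (M + m)) (f := fun k => star (offDiagOp m a v k) * x k)]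
      · refine Finset.sum_congr rfl fun k hk => ?_
        simp only [Finset.mem_range] at hk
        rw [offDiag_repr v k (M + m) (by omega), star_sum, Finset.sum_mul]
        refine Finset.sum_congr rfl fun j _ => ?_
        rw [aK_symm (k : ℤ) (j : ℤ)]
        simp only [star_mul', RCLike.star_def, Complex.conj_ofReal]; ring
      · intro k hk; simp only [Finset.mem_range] at *; omega
      · intro k _ hk
        simp only [Finset.mem_range] at *
        rw [hx k (by omega), mul_zero]
    rw [this, ← Finset.sum_add_distrib]
    refine Finset.sum_congr rfl fun k _ => ?_
    unfold bandOp
    simp only [star_add, star_mul', RCLike.star_def, Complex.conj_ofReal]; ring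
  rw [Finset.sum_congr rfl e1, Finset.sum_add_distrib, e2, Finset.sum_comm]

lemma err_bound (hy : Hy m n1 d a δ κ K c0) : ∃ C : ℝ, 0 ≤ C ∧ ∀ M : ℕ, 0 < M → ∀ x : ℕ → ℂ,
    ‖∑ j ∈ Finset.range M, star (x j) * bandOp m d a x j -
      qf ((Matrix.diagonal fun j : Fin M => ((d j : ℝ) : ℂ)) + toM M (hk m a M)) (fun j : Fin M => x j)‖ ≤
    C / M * ∑ j ∈ Finset.range (M + m), br (j : ℤ) ^ (δ + 1) * ‖x j‖ ^ 2 := by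
  have hK := hy.hK
  set C1 := K * (1 + m) * (1 + m : ℝ) ^ |δ + 1| with hC1
  have hC1p : 0 ≤ C1 := by positivity
  refine ⟨C1 * (1 + (1 + m : ℝ) ^ |δ + 1|) * (2 * m + 1), by positivity, fun M hM x => ?_⟩
  have hM' : (0 : ℝ) < M := by exact_mod_cast hM
  have hq := quad_bound (fun j k => aK m a j k - hk m a M j k) (C1 / M) (δ + 1) (by positivity) m (M + m)
    (fun j => ‖x j‖) (fun _ => norm_nonneg _) ?_ ?_
  · have e : ∑ j ∈ Finset.range M, star (x j) * bandOp m d a x j -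
      qf ((Matrix.diagonal fun j : Fin M => ((d j : ℝ) : ℂ)) + toM M (hk m a M)) (fun j : Fin M => x j) =
      ∑ j ∈ Finset.range M, ∑ k ∈ Finset.range (M + m), star (x j) * (((aK m a j k - hk m a M j k : ℝ) : ℂ) * x k) := by
      have e2 : qf ((Matrix.diagonal fun j : Fin M => ((d j : ℝ) : ℂ)) + toM M (hk m a M)) (fun j : Fin M => x j)
         = ∑ j ∈ Finset.range M, star (x j) * (d j * x j + ∑ k ∈ Finset.range (M + m), (hk m a M j k : ℂ) * x k) := by
        unfold qf
        rw [Matrix.add_mulVec, dotProduct, Finset.sum_range]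
        refine Finset.sum_congr rfl fun j _ => ?_
        rw [Pi.star_apply, Pi.add_apply, Matrix.mulVec_diagonal, Matrix.mulVec, dotProduct]
        congr 2
        simp only [toM, Matrix.of_apply]
        rw [← Finset.sum_range fun k : ℕ => (hk m a M (j : ℕ) k : ℂ) * x k]
        apply Finset.sum_subset
        · intro k hk; simp only [Finset.mem_range] at *; omega
        · intro k _ hk'
          simp only [Finset.mem_range] at hk'
          unfold hk
          rw [bm_supp _ _ m M (cf_l M) (cf_s M hM) _ _ (by omega)]; simp
      rw [e2, ← Finset.sum_sub_distrib]
      refine Finset.sum_congr rfl fun j hj => ?_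
      simp only [Finset.mem_range] at hj
      unfold bandOp
      rw [offDiag_repr x j (M + m) (by omega), ← mul_sub, add_sub_add_left_eq_sub,
        ← Finset.sum_sub_distrib, Finset.mul_sum]
      refine Finset.sum_congr rfl fun k _ => ?_
      push_cast; ring
    rw [e]
    calc _ ≤ ∑ j ∈ Finset.range M, ∑ k ∈ Finset.range (M + m), |aK m a j k - hk m a M j k| * (‖x j‖ * ‖x k‖) := by
          refine (norm_sum_le _ _).trans (Finset.sum_le_sum fun j _ => ?_)
          refine (norm_sum_le _ _).trans (Finset.sum_le_sum fun k _ => le_of_eq ?_)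
          rw [norm_mul, norm_star, norm_mul, Complex.norm_real, Real.norm_eq_abs]; ring
      _ ≤ ∑ j ∈ Finset.range (M + m), ∑ k ∈ Finset.range (M + m), |aK m a j k - hk m a M j k| * (‖x j‖ * ‖x k‖) := by
          apply Finset.sum_le_sum_of_subset_of_nonneg
          · intro k hk; simp only [Finset.mem_range] at *; omega
          · intro j _ _
            exact Finset.sum_nonneg fun k _ => by positivity
      _ ≤ _ := hq
      _ = _ := by ring
  · intro j k _ _ h
    rw [hk_nat, aK_zero _ _ h]; simp
  · intro j k _ _
    have hb := brw j (δ + 1)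
    rw [hk_nat]
    by_cases hl : (m : ℤ) < |(j : ℤ) - k|
    · rw [aK_zero _ _ hl]; simp; positivity
    rw [aK_nat]
    split_ifs with h
    · have e : a ((j : ℤ) - k).natAbs (min j k) - chi m M (min j k) * a ((j : ℤ) - k).natAbs (min j k) =
        (1 - chi m M (min j k)) * a ((j : ℤ) - k).natAbs (min j k) := by ring
      have h1 := one_sub_chi m M (min j k)
      have h2 := chi_le_one m M (min j k)
      have h3 := hy.ha _ (Finset.mem_Icc.2 h) (min j k)
      set i := min j k with hi
      have h4 := br_slow_rpow (j : ℤ) (i : ℤ) m (by rw [not_lt, abs_le] at hl; rw [abs_le]; omega) (δ + 1)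
      rw [e, abs_mul, abs_of_nonneg (by linarith)]
      have hbi := br_pos (i : ℤ)
      have := brw i δ
      have h5 : (i : ℝ) + m ≤ (1 + m) * br (i : ℤ) := by
        rw [br_nat]
        have : (0 : ℝ) ≤ i := Nat.cast_nonneg i
        have : (0 : ℝ) ≤ m := Nat.cast_nonneg m
        nlinarith
      calc _ ≤ ((1 + m) * br (i : ℤ) / M) * (K * br (i : ℤ) ^ δ) := by
            gcongr
            refine h1.trans ?_
            gcongr
        _ = K * (1 + m) / M * br (i : ℤ) ^ (δ + 1) := by
            rw [Real.rpow_add_one hbi.ne']; ring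
        _ ≤ K * (1 + m) / M * ((1 + m : ℝ) ^ |δ + 1| * br (j : ℤ) ^ (δ + 1)) := by gcongr
        _ = _ := by rw [hC1]; ring
    · simp; positivity

end Part6

section Part7
variable {m n1 : ℕ} {d : ℕ → ℝ} {a : ℕ → ℕ → ℝ} {δ κ K c0 : ℝ}

lemma glob (f g : ℕ → ℝ) (hg : ∀ j, 0 < g j) (C : ℝ) (h : ∀ᶠ j in atTop, f j ≤ C * g j) :
    ∃ C' : ℝ, 0 ≤ C' ∧ ∀ j, f j ≤ C' * g j := by
  obtain ⟨N, hN⟩ := eventually_atTop.1 h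
  refine ⟨|C| + ∑ j ∈ Finset.range N, |f j| / g j, ?_, fun j => ?_⟩
  · have : ∀ j ∈ Finset.range N, 0 ≤ |f j| / g j := fun j _ => div_nonneg (abs_nonneg _) (hg j).le
    have := Finset.sum_nonneg this
    positivity
  have hnn : ∀ j ∈ Finset.range N, 0 ≤ |f j| / g j := fun j _ => div_nonneg (abs_nonneg _) (hg j).le
  by_cases hj : N ≤ j
  · refine (hN j hj).trans (mul_le_mul_of_nonneg_right ?_ (hg j).le)
    have := Finset.sum_nonneg hnn
    have := le_abs_self C
    linarith
  · have h1 := Finset.single_le_sum hnn (Finset.mem_range.2 (not_le.1 hj))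
    have h2 : |f j| / g j * g j = |f j| := div_mul_cancel₀ _ (hg j).ne'
    have h3 := mul_le_mul_of_nonneg_right h1 (hg j).le
    have h4 := le_abs_self (f j)
    have h5 := mul_nonneg (abs_nonneg C) (hg j).le
    nlinarith

lemma br_tendsto (p : ℝ) (hp : 0 < p) : Tendsto (fun j : ℕ => br (j : ℤ) ^ p) atTop atTop := by
  refine (tendsto_rpow_atTop hp).comp ?_
  have : (fun j : ℕ => br (j : ℤ)) = fun j : ℕ => (j : ℝ) + 1 := funext fun j => br_nat j
  rw [this]
  exact tendsto_atTop_add_const_right _ _ tendsto_natCast_atTop_atTop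

lemma br_nat_pos (j : ℕ) (τ : ℝ) : 0 < br (j : ℤ) ^ τ := Real.rpow_pos_of_pos (br_pos _) _

/-- domination of a lower power by a higher one -/
lemma br_dom (C ε σ τ : ℝ) (hε : 0 < ε) (h : σ < τ) :
    ∀ᶠ j : ℕ in atTop, C * br (j : ℤ) ^ σ ≤ ε * br (j : ℤ) ^ τ := by
  filter_upwards [(br_tendsto (τ - σ) (by linarith)).eventually_ge_atTop (C / ε)] with j hj
  have e : br (j : ℤ) ^ τ = br (j : ℤ) ^ (τ - σ) * br (j : ℤ) ^ σ := by
    rw [← Real.rpow_add (br_pos _)]; congr 1; ring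
  rw [div_le_iff₀ hε] at hj
  rw [e]
  have := br_nat_pos j σ
  nlinarith

lemma d_growth (hy : Hy m n1 d a δ κ K c0) (hs : 0 < δ + κ) :
    ∃ c : ℝ, 0 < c ∧ ∀ᶠ j : ℕ in atTop, c * br (j : ℤ) ^ (δ + κ) ≤ d j := by
  obtain ⟨C, hC, hdiff⟩ := br_diff_rpow 1 (δ + κ)
  have hc0 := hy.hc0
  set c := c0 / C with hc
  have hcp : 0 < c := by positivity
  have step : ∀ j, n1 ≤ j → d n1 - c * br (n1 : ℤ) ^ (δ + κ) ≤ d j - c * br (j : ℤ) ^ (δ + κ) := by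
    intro j hj
    induction j, hj using Nat.le_induction with
    | base => exact le_rfl
    | succ j hj ih =>
      have h1 := hy.hd j hj
      have h2 := hdiff (j : ℤ) ((j + 1 : ℕ) : ℤ) (by push_cast; simp)
      have h3 := (abs_le.1 h2).2
      have h4 : c * (br ((j + 1 : ℕ) : ℤ) ^ (δ + κ) - br (j : ℤ) ^ (δ + κ)) ≤ c * (C * br (j : ℤ) ^ (δ + κ - 1)) :=
        mul_le_mul_of_nonneg_left h3 hcp.le
      have h5 : c * (C * br (j : ℤ) ^ (δ + κ - 1)) = c0 * br (j : ℤ) ^ (δ + κ - 1) := by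
        rw [hc]; field_simp
      linarith
  refine ⟨c / 2, by positivity, ?_⟩
  filter_upwards [eventually_ge_atTop n1, (br_tendsto (δ + κ) hs).eventually_ge_atTop
    ((c * br (n1 : ℤ) ^ (δ + κ) - d n1) / (c / 2))] with j hj h
  rw [div_le_iff₀ (by positivity)] at h
  have := step j hj
  linarith

lemma e_mono (hy : Hy m n1 d a δ κ K c0) (C : ℝ) :
    ∃ N : ℕ, ∀ j k, N ≤ j → j ≤ k →
      d j + C * br (j : ℤ) ^ (δ - κ) ≤ d k + C * br (k : ℤ) ^ (δ - κ) := by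
  obtain ⟨B, hB, hdiff⟩ := br_diff_rpow 1 (δ - κ)
  have hκ := hy.hκ
  obtain ⟨N, hN⟩ := eventually_atTop.1 (br_dom (|C| * B) c0 (δ - κ - 1) (δ + κ - 1) hy.hc0 (by linarith))
  refine ⟨max N n1, fun j k hj hk => ?_⟩
  induction k, hk using Nat.le_induction with
  | base => exact le_rfl
  | succ k hk ih =>
    have h1 := hy.hd k (by omega)
    have h2 := hdiff (k : ℤ) ((k + 1 : ℕ) : ℤ) (by push_cast; simp)
    have h3 := hN k (by omega)
    have h4 : |C * (br ((k + 1 : ℕ) : ℤ) ^ (δ - κ) - br (k : ℤ) ^ (δ - κ))| ≤ |C| * (B * br (k : ℤ) ^ (δ - κ - 1)) := by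
      rw [abs_mul]; gcongr
    have h5 := (abs_le.1 h4).1
    linarith

lemma e_tendsto (hy : Hy m n1 d a δ κ K c0) (hs : 0 < δ + κ) (C : ℝ) :
    Tendsto (fun j : ℕ => d j + C * br (j : ℤ) ^ (δ - κ)) atTop atTop := by
  obtain ⟨c, hc, h⟩ := d_growth hy hs
  have hκ := hy.hκ
  refine tendsto_atTop_mono' _ ?_ ((br_tendsto (δ + κ) hs).const_mul_atTop (half_pos hc))
  filter_upwards [h, br_dom (-C) (c / 2) (δ - κ) (δ + κ) (half_pos hc) (by linarith)] with j h1 h2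
  linarith

lemma e_upper (hy : Hy m n1 d a δ κ K c0) (hs : 0 < δ + κ) (C : ℝ) :
    ∀ᶠ n : ℕ in atTop, ∀ j, j ≤ n →
      d j + C * br (j : ℤ) ^ (δ - κ) ≤ d n + C * br (n : ℤ) ^ (δ - κ) := by
  obtain ⟨N, hN⟩ := e_mono hy C
  filter_upwards [eventually_ge_atTop N, (e_tendsto hy hs C).eventually_ge_atTop
    (∑ j ∈ Finset.range N, |d j + C * br (j : ℤ) ^ (δ - κ)|)] with n hn h j hj
  by_cases hjN : N ≤ j
  · exact hN j n hjN hj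
  · refine le_trans ?_ h
    exact (le_abs_self _).trans (Finset.single_le_sum (f := fun j : ℕ => |d j + C * br (j : ℤ) ^ (δ - κ)|)
      (fun _ _ => abs_nonneg _) (Finset.mem_range.2 (not_le.1 hjN)))

lemma offDiag_bound (hy : Hy m n1 d a δ κ K c0) (v : ℕ → ℂ) (C τ : ℝ) (hC : 0 ≤ C)
    (hv : ∀ j : ℕ, ‖v j‖ ≤ C * br (j : ℤ) ^ τ) :
    ∃ C' : ℝ, ∀ j : ℕ, ‖offDiagOp m a v j‖ ≤ C' * br (j : ℤ) ^ (δ + τ) := by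
  have hK := hy.hK
  set Q := K * (1 + m : ℝ) ^ |δ| * (C * (1 + m : ℝ) ^ |τ|) with hQ
  have hm1 : (1 : ℝ) ≤ 1 + m := by have : (0 : ℝ) ≤ m := Nat.cast_nonneg m; linarith
  have key : ∀ l ∈ Finset.Icc 1 m, ∀ i k j : ℕ, |(j : ℤ) - i| ≤ m → |(j : ℤ) - k| ≤ m →
      ‖(a l i : ℂ) * v k‖ ≤ Q * br (j : ℤ) ^ (δ + τ) := by
    intro l hl i k j hi hk
    rw [norm_mul, Complex.norm_real, Real.norm_eq_abs]
    have h1 := hy.ha l hl i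
    have h2 := hv k
    have h3 := br_slow_rpow (j : ℤ) i m (by exact_mod_cast hi) δ
    have h4 := br_slow_rpow (j : ℤ) k m (by exact_mod_cast hk) τ
    have := br_nat_pos k τ
    have := br_nat_pos j δ
    have := br_nat_pos i δ
    calc _ ≤ (K * ((1 + m : ℝ) ^ |δ| * br (j : ℤ) ^ δ)) * (C * ((1 + m : ℝ) ^ |τ| * br (j : ℤ) ^ τ)) := by
          gcongr
          · exact h1.trans (by gcongr)
          · exact h2.trans (by gcongr)
      _ = _ := by rw [Real.rpow_add (br_pos _), hQ]; ring
  refine ⟨∑ l ∈ Finset.Icc 1 m, 2 * Q, fun j => ?_⟩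
  unfold offDiagOp
  rw [Finset.sum_mul]
  refine (norm_sum_le _ _).trans (Finset.sum_le_sum fun l hl => ?_)
  have hl' := Finset.mem_Icc.1 hl
  refine (norm_add_le _ _).trans ?_
  have k1 := key l hl j (j + l) j (by simp) (by rw [abs_le]; omega)
  have hQ0 : 0 ≤ Q * br (j : ℤ) ^ (δ + τ) := (norm_nonneg _).trans k1
  split_ifs with h
  · have k2 := key l hl (j - l) (j - l) j (by rw [abs_le]; omega) (by rw [abs_le]; omega)
    linarith
  · rw [norm_zero]; linarith

lemma decay (hy : Hy m n1 d a δ κ K c0) (hs : 0 < δ + κ) (v : ℕ → ℂ) (lam : ℝ)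
    (hv : ∀ j, bandOp m d a v j = lam * v j) (B : ℝ) (hB : ∀ j, ‖v j‖ ≤ B) (p : ℕ) :
    ∃ C : ℝ, 0 ≤ C ∧ ∀ j : ℕ, ‖v j‖ ≤ C * br (j : ℤ) ^ (-(p * κ)) := by
  induction p with
  | zero => exact ⟨B, (norm_nonneg _).trans (hB 0), fun j => by simpa using hB j⟩
  | succ p ih =>
    obtain ⟨C, hC, h⟩ := ih
    obtain ⟨C', h'⟩ := offDiag_bound hy v C _ hC h
    obtain ⟨c, hc, hg⟩ := d_growth hy hs
    have h3 : ∀ᶠ j : ℕ in atTop, ‖v j‖ ≤ (C' / (c / 2)) * br (j : ℤ) ^ (-((p + 1 : ℕ) * κ)) := by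
      filter_upwards [hg, br_dom lam (c / 2) 0 (δ + κ) (half_pos hc) hs] with j h1 h2
      rw [Real.rpow_zero, mul_one] at h2
      have e : (((d j - lam : ℝ)) : ℂ) * v j = - offDiagOp m a v j := by
        have := hv j
        unfold bandOp at this
        push_cast
        linear_combination this
      have e2 : |d j - lam| * ‖v j‖ = ‖offDiagOp m a v j‖ := by
        rw [← norm_neg (offDiagOp m a v j), ← e, norm_mul, Complex.norm_real, Real.norm_eq_abs]
      have h4 : c / 2 * br (j : ℤ) ^ (δ + κ) * ‖v j‖ ≤ C' * br (j : ℤ) ^ (δ + -(p * κ)) := by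
        refine le_trans ?_ (h' j)
        rw [← e2]
        gcongr
        exact le_trans (by linarith) (le_abs_self _)
      have e3 : br (j : ℤ) ^ (δ + -(p * κ)) = br (j : ℤ) ^ (δ + κ) * br (j : ℤ) ^ (-((p + 1 : ℕ) * κ)) := by
        rw [← Real.rpow_add (br_pos _)]; congr 1; push_cast; ring
      rw [e3] at h4
      have hp := br_nat_pos j (δ + κ)
      have h5 : c / 2 * ‖v j‖ ≤ C' * br (j : ℤ) ^ (-((p + 1 : ℕ) * κ)) := by
        refine le_of_mul_le_mul_left ?_ hp
        linarith
      rw [div_mul_eq_mul_div, le_div_iff₀ (half_pos hc)]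
      linarith
    exact glob _ _ (fun j => br_nat_pos j _) _ h3

lemma decay' (hy : Hy m n1 d a δ κ K c0) (hs : 0 < δ + κ) (v : ℕ → ℂ) (lam : ℝ)
    (hv : ∀ j, bandOp m d a v j = lam * v j) (B : ℝ) (hB : ∀ j, ‖v j‖ ≤ B) :
    Summable fun j : ℕ => br (j : ℤ) ^ (δ + 1) * ‖v j‖ ^ 2 := by
  have hκ := hy.hκ
  obtain ⟨p, hp⟩ := exists_nat_ge ((δ + 3) / (2 * κ))
  rw [div_le_iff₀ (by positivity)] at hp
  obtain ⟨C, hC, h⟩ := decay hy hs v lam hv B hB p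
  have hsum : Summable fun j : ℕ => C ^ 2 * br (j : ℤ) ^ (-2 : ℝ) := by
    refine Summable.mul_left _ ?_
    have h0 : Summable fun j : ℕ => ((j : ℝ)) ^ (-2 : ℝ) := Real.summable_nat_rpow.2 (by norm_num)
    have h1 := (summable_nat_add_iff 1).2 h0
    refine h1.congr fun j => ?_
    rw [br_nat]; push_cast; rfl
  refine Summable.of_nonneg_of_le (fun j => by have := br_nat_pos j (δ + 1); positivity) (fun j => ?_) hsum
  have h1 := h j
  have h2 := br_nat_pos j (δ + 1)
  calc _ ≤ br (j : ℤ) ^ (δ + 1) * (C * br (j : ℤ) ^ (-(p * κ))) ^ 2 := by gcongr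
    _ = C ^ 2 * br (j : ℤ) ^ (δ + 1 + -(p * κ) + -(p * κ)) := by
      rw [Real.rpow_add (br_pos _) (δ + 1 + -(p * κ)), Real.rpow_add (br_pos _) (δ + 1)]; ring
    _ ≤ _ := by
      gcongr
      · exact br_one_le _
      · linarith

end Part7

section Part8
variable {m n1 : ℕ} {d : ℕ → ℝ} {a : ℕ → ℕ → ℝ} {δ κ K c0 : ℝ}

lemma ker_vec (n : ℕ) (A : Matrix (Fin n) (Fin (n + 1)) ℂ) : ∃ c : Fin (n + 1) → ℂ, c ≠ 0 ∧ A.mulVec c = 0 := by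
  have h : LinearMap.ker A.mulVecLin ≠ ⊥ := LinearMap.ker_ne_bot_of_finrank_lt (by simp)
  obtain ⟨c, hc, hc0⟩ := (Submodule.ne_bot_iff _).1 h
  exact ⟨c, hc0, by simpa using hc⟩

noncomputable def toLp (x : ℕ → ℂ) (M : ℕ) (hx : ∀ k, M ≤ k → x k = 0) : lp (fun _ : ℕ => ℂ) 2 :=
  ⟨x, memℓp_gen (summable_of_ne_finset_zero (s := Finset.range M) (fun b hb => by
    rw [hx b (by simpa using hb)]; simp))⟩

lemma toLp_apply (x : ℕ → ℂ) (M : ℕ) (hx : ∀ k, M ≤ k → x k = 0) (j : ℕ) : (toLp x M hx) j = x j := rfl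

lemma inner_toLp (w : lp (fun _ : ℕ => ℂ) 2) (x : ℕ → ℂ) (M N : ℕ) (hx : ∀ k, M ≤ k → x k = 0) (hN : M ≤ N) :
    inner ℂ w (toLp x M hx) = ∑ j ∈ Finset.range N, star (w j) * x j := by
  refine (lp.hasSum_inner w (toLp x M hx)).unique ?_
  have e : ∑ j ∈ Finset.range N, star (w j) * x j =
      ∑ j ∈ Finset.range N, inner ℂ (w j) ((toLp x M hx) j) :=
    Finset.sum_congr rfl fun j _ => by
      rw [toLp_apply, RCLike.inner_apply, mul_comm]; rfl
  rw [e]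
  refine hasSum_sum_of_ne_finset_zero fun b hb => ?_
  rw [toLp_apply, hx b (by simp at hb; omega)]; simp

lemma minmax_up (lam : ℕ → ℝ) (v : ℕ → lp (fun _ : ℕ => ℂ) 2) (heig : IsEigenSystem m d a lam v)
    (n M : ℕ) (x : ℕ → ℂ) (hx : ∀ k, M ≤ k → x k = 0)
    (horth : ∀ k < n, ∑ j ∈ Finset.range M, star (v k j) * x j = 0) :
    lam n * ∑ j ∈ Finset.range M, ‖x j‖ ^ 2 ≤
      (∑ j ∈ Finset.range M, star (x j) * bandOp m d a x j).re := by
  obtain ⟨hv, hcl, hmono, -, he⟩ := heig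
  set X := toLp x M hx with hX
  set Y := toLp (bandOp m d a x) (M + m) (bandOp_supp_zero x M hx) with hY
  let b := HilbertBasis.mk hv hcl.ge
  have hb : ∀ i, b i = v i := fun i => by simp [b]
  have hXv : ∀ i, inner ℂ (v i) X = ∑ j ∈ Finset.range M, star (v i j) * x j := fun i =>
    inner_toLp _ _ _ _ hx le_rfl
  have hYv : ∀ i, inner ℂ (v i) Y = lam i * inner ℂ (v i) X := fun i => by
    rw [hY, inner_toLp _ _ _ _ _ le_rfl, bandOp_symm x _ M hx, hX, inner_toLp _ _ M (M + m) hx (by omega), Finset.mul_sum]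
    refine Finset.sum_congr rfl fun j _ => ?_
    rw [he i j]
    simp only [star_mul', RCLike.star_def, Complex.conj_ofReal]; ring
  have hs1 := b.hasSum_inner_mul_inner X Y
  have hs2 := b.hasSum_inner_mul_inner X X
  have e1 : ∀ i, inner ℂ X (b i) * inner ℂ (b i) X = ((‖inner ℂ (v i) X‖ ^ 2 : ℝ) : ℂ) := fun i => by
    rw [hb, ← inner_conj_symm X (v i), Complex.conj_mul']; push_cast; rfl
  have e2 : ∀ i, inner ℂ X (b i) * inner ℂ (b i) Y = ((lam i * ‖inner ℂ (v i) X‖ ^ 2 : ℝ) : ℂ) := fun i => by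
    rw [Complex.ofReal_mul, ← e1, hb, hYv]; ring
  simp only [e1] at hs2
  simp only [e2] at hs1
  have hr1 := Complex.hasSum_re hs1
  have hr2 := (Complex.hasSum_re hs2).mul_left (lam n)
  simp only [Complex.ofReal_re] at hr1 hr2
  have hle := hasSum_le (fun i => ?_) hr2 hr1
  · have eXX : inner ℂ X X = ((∑ j ∈ Finset.range M, ‖x j‖ ^ 2 : ℝ) : ℂ) := by
      rw [hX, inner_toLp _ _ M M hx le_rfl]
      push_cast
      refine Finset.sum_congr rfl fun j _ => ?_
      rw [toLp_apply]
      exact Complex.conj_mul' _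
    have eXY : inner ℂ X Y = ∑ j ∈ Finset.range M, star (x j) * bandOp m d a x j := by
      rw [hY, inner_toLp _ _ _ _ _ le_rfl]
      symm
      apply Finset.sum_subset
      · intro k hk; simp only [Finset.mem_range] at *; omega
      · intro k _ hk
        simp only [Finset.mem_range] at hk
        rw [hx k (by omega)]; simp
    rw [eXX, eXY, Complex.ofReal_re] at hle
    exact hle
  · by_cases hi : i < n
    · rw [hXv, horth i hi]; simp
    · have := hmono (not_lt.1 hi)
      gcongr

end Part8

section Part9
variable {m n1 : ℕ} {d : ℕ → ℝ} {a : ℕ → ℕ → ℝ} {δ κ K c0 : ℝ}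

lemma unit_norm {M : ℕ} (U : Matrix (Fin M) (Fin M) ℂ) (hU : U.conjTranspose * U = 1) (y : Fin M → ℂ) :
    ∑ j, ‖U.mulVec y j‖ ^ 2 = ∑ j, ‖y j‖ ^ 2 := by
  have h : ∀ z : Fin M → ℂ, qf 1 z = ((∑ j, ‖z j‖ ^ 2 : ℝ) : ℂ) := fun z => by
    have := qf_diag (fun _ : Fin M => (1 : ℝ)) z
    simpa using this
  have h1 : qf 1 (U.mulVec y) = qf 1 y := by
    rw [qf_conj, mul_one, hU]
  rw [h, h] at h1
  exact_mod_cast h1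

lemma upper (hy : Hy m n1 d a δ κ K c0) (hs : 0 < δ + κ) (lam : ℕ → ℝ) (v : ℕ → lp (fun _ : ℕ => ℂ) 2)
    (heig : IsEigenSystem m d a lam v) :
    ∃ C : ℝ, ∀ᶠ n : ℕ in atTop, lam n ≤ d n + C * br (n : ℤ) ^ (δ - κ) := by
  obtain ⟨CF, hCF, hF⟩ := thmF hy
  obtain ⟨Ce, hCe, hE⟩ := err_bound hy
  refine ⟨CF, ?_⟩
  filter_upwards [e_upper hy hs CF] with n hn
  set W := ∑ j ∈ Finset.range (n + 1), br (j : ℤ) ^ (δ + 1) with hW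
  have hWj : ∀ j, j ≤ n → br (j : ℤ) ^ (δ + 1) ≤ W := fun j hj =>
    Finset.single_le_sum (f := fun j : ℕ => br (j : ℤ) ^ (δ + 1)) (fun i _ => (br_nat_pos i _).le)
      (Finset.mem_range.2 (by omega))
  have main : ∀ M : ℕ, n < M → lam n ≤ d n + CF * br (n : ℤ) ^ (δ - κ) + Ce * CF * W * (1 / (M : ℝ)) := by
    intro M hM
    obtain ⟨U, hU, h1, h2⟩ := hF M (by omega)
    let V : Matrix (Fin n) (Fin M) ℂ := Matrix.of fun k j => star (v k j)
    let E : Matrix (Fin M) (Fin (n + 1)) ℂ := Matrix.of fun j i => if (j : ℕ) = i then 1 else 0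
    obtain ⟨c, hc, hker⟩ := ker_vec n (V * (U * E))
    set y := E.mulVec c with hyd
    have hy1 : ∀ i : Fin (n + 1), y ⟨i, by omega⟩ = c i := fun i => by
      simp [hyd, E, Matrix.mulVec, dotProduct, Fin.val_inj]
    have hy2 : ∀ j : Fin M, n < (j : ℕ) → y j = 0 := fun j hj => by
      simp only [hyd, E, Matrix.mulVec, dotProduct, Matrix.of_apply]
      refine Finset.sum_eq_zero fun i _ => ?_
      rw [if_neg (by omega), zero_mul]
    have hypos : 0 < ∑ j, ‖y j‖ ^ 2 := by
      obtain ⟨i, hi⟩ := Function.ne_iff.1 hc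
      refine Finset.sum_pos' (fun _ _ => by positivity) ⟨⟨i, by omega⟩, Finset.mem_univ _, ?_⟩
      rw [hy1]
      have : 0 < ‖c i‖ := norm_pos_iff.2 hi
      positivity
    set z := U.mulVec y with hz
    set x : ℕ → ℂ := fun j => if h : j < M then z ⟨j, h⟩ else 0 with hxd
    have hxz : (fun j : Fin M => x j) = z := by
      funext j; simp [hxd]
    have hxz' : ∀ j : Fin M, x j = z j := fun j => congrFun hxz j
    have hx0 : ∀ k, M ≤ k → x k = 0 := fun k hk => by simp [hxd, hk]
    have horth : ∀ k < n, ∑ j ∈ Finset.range M, star (v k j) * x j = 0 := by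
      intro k hk
      have := congrFun hker ⟨k, hk⟩
      rw [← Matrix.mulVec_mulVec, ← Matrix.mulVec_mulVec, ← hyd, ← hz] at this
      rw [Finset.sum_range]
      simp only [hxz']
      exact this
    have hmm := minmax_up lam v heig n M x hx0 horth
    have herr := hE M (by omega) x
    rw [hxz] at herr
    have hsx : ∑ j ∈ Finset.range M, ‖x j‖ ^ 2 = ∑ j, ‖y j‖ ^ 2 := by
      rw [Finset.sum_range]
      simp only [hxz']
      exact unit_norm U hU y
    have hwx : ∑ j ∈ Finset.range (M + m), br (j : ℤ) ^ (δ + 1) * ‖x j‖ ^ 2 ≤ CF * (W * ∑ j, ‖y j‖ ^ 2) := by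
      have : ∑ j ∈ Finset.range (M + m), br (j : ℤ) ^ (δ + 1) * ‖x j‖ ^ 2 =
          ∑ j ∈ Finset.range M, br (j : ℤ) ^ (δ + 1) * ‖x j‖ ^ 2 := by
        symm
        apply Finset.sum_subset
        · intro k hk; simp only [Finset.mem_range] at *; omega
        · intro k _ hk
          simp only [Finset.mem_range] at hk
          rw [hx0 k (by omega)]; simp
      rw [this, Finset.sum_range]
      simp only [hxz']
      refine (h2 y).trans (mul_le_mul_of_nonneg_left ?_ hCF)
      rw [Finset.mul_sum]
      refine Finset.sum_le_sum fun j _ => ?_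
      by_cases hj : n < (j : ℕ)
      · rw [hy2 j hj]; simp
      · exact mul_le_mul_of_nonneg_right (hWj j (by omega)) (by positivity)
    have hq := h1 y
    rw [← hz, qf_diag (fun j : Fin M => d j)] at hq
    have hsum : ∑ j : Fin M, d j * ‖y j‖ ^ 2 + CF * ∑ j : Fin M, br ((j : ℕ) : ℤ) ^ (δ - κ) * ‖y j‖ ^ 2 ≤
        (d n + CF * br (n : ℤ) ^ (δ - κ)) * ∑ j, ‖y j‖ ^ 2 := by
      rw [Finset.mul_sum, Finset.mul_sum, ← Finset.sum_add_distrib]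
      refine Finset.sum_le_sum fun j _ => ?_
      by_cases hj : n < (j : ℕ)
      · rw [hy2 j hj]; simp
      · have h3 := hn j (by omega)
        have : (0 : ℝ) ≤ ‖y j‖ ^ 2 := by positivity
        nlinarith
    have hq' := (Complex.re_le_norm _).trans hq
    have herr' := (Complex.re_le_norm _).trans herr
    rw [Complex.sub_re] at hq' herr'
    rw [Complex.ofReal_re] at hq'
    rw [hsx] at hmm
    have hM0 : (0 : ℝ) < M := by exact_mod_cast (by omega : 0 < M)
    have herr2 : Ce / M * ∑ j ∈ Finset.range (M + m), br (j : ℤ) ^ (δ + 1) * ‖x j‖ ^ 2 ≤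
        (Ce * CF * W * (1 / (M : ℝ))) * ∑ j, ‖y j‖ ^ 2 := by
      refine (mul_le_mul_of_nonneg_left hwx (by positivity)).trans (le_of_eq ?_)
      ring
    refine le_of_mul_le_mul_right ?_ hypos
    rw [add_mul]
    linarith
  have hlim : Tendsto (fun M : ℕ => d n + CF * br (n : ℤ) ^ (δ - κ) + Ce * CF * W * (1 / (M : ℝ))) atTop
      (nhds (d n + CF * br (n : ℤ) ^ (δ - κ) + Ce * CF * W * 0)) :=
    (tendsto_one_div_atTop_nhds_zero_nat.const_mul _).const_add _
  rw [mul_zero, add_zero] at hlim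
  exact ge_of_tendsto hlim ((eventually_gt_atTop n).mono main)

end Part9

section Part10
variable {m n1 : ℕ} {d : ℕ → ℝ} {a : ℕ → ℕ → ℝ} {δ κ K c0 : ℝ}

lemma ker_vec' (n : ℕ) (A : Matrix (Fin n) (Fin (n + 1)) ℂ) :
    ∃ c : Fin (n + 1) → ℂ, ∑ k, ‖c k‖ ^ 2 = 1 ∧ A.mulVec c = 0 := by
  obtain ⟨c, hc, h⟩ := ker_vec n A
  have hp : 0 < ∑ k, ‖c k‖ ^ 2 := by
    obtain ⟨i, hi⟩ := Function.ne_iff.1 hc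
    refine Finset.sum_pos' (fun _ _ => by positivity) ⟨i, Finset.mem_univ _, ?_⟩
    have : 0 < ‖c i‖ := norm_pos_iff.2 hi
    positivity
  set r := ∑ k, ‖c k‖ ^ 2 with hr
  refine ⟨((Real.sqrt r)⁻¹ : ℂ) • c, ?_, by rw [Matrix.mulVec_smul, h, smul_zero]⟩
  have : ∀ k, ‖(((Real.sqrt r)⁻¹ : ℂ) • c) k‖ ^ 2 = r⁻¹ * ‖c k‖ ^ 2 := fun k => by
    rw [Pi.smul_apply, smul_eq_mul, norm_mul, norm_inv, Complex.norm_real, Real.norm_eq_abs,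
      abs_of_nonneg (Real.sqrt_nonneg _), mul_pow, inv_pow, Real.sq_sqrt hp.le]
  simp only [this]
  rw [← Finset.mul_sum, ← hr, inv_mul_cancel₀ hp.ne']

lemma tail_lem (f : ℕ → ℂ) (s : ℂ) (g : ℕ → ℝ) (hf : HasSum f s) (hg : Summable g) (h : ∀ j, ‖f j‖ ≤ g j) (M : ℕ) :
    ‖s - ∑ j ∈ Finset.range M, f j‖ ≤ ∑' j, g (j + M) := by
  have h1 := (hasSum_nat_add_iff' M).2 hf
  rw [← h1.tsum_eq]
  exact tsum_of_norm_bounded ((summable_nat_add_iff M).2 hg).hasSum fun j => h _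

lemma bandOp_sum (n : ℕ) (c : Fin n → ℂ) (v : Fin n → ℕ → ℂ) (j : ℕ) :
    bandOp m d a (fun j => ∑ k, c k * v k j) j = ∑ k, c k * bandOp m d a (v k) j := by
  unfold bandOp
  have hr : ∀ x : ℕ → ℂ, offDiagOp m a x j = _ := fun x => offDiag_repr x j (j + m + 1) (by omega)
  simp only [hr]
  simp only [mul_add, Finset.mul_sum, Finset.sum_add_distrib]
  congr 1
  · refine Finset.sum_congr rfl fun k _ => by ring
  · rw [Finset.sum_comm]
    refine Finset.sum_congr rfl fun k _ => Finset.sum_congr rfl fun i _ => by ring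

lemma lower (hy : Hy m n1 d a δ κ K c0) (hs : 0 < δ + κ) (lam : ℕ → ℝ) (v : ℕ → lp (fun _ : ℕ => ℂ) 2)
    (heig : IsEigenSystem m d a lam v) :
    ∃ C : ℝ, ∀ᶠ n : ℕ in atTop, d n - C * br (n : ℤ) ^ (δ - κ) ≤ lam n := by
  obtain ⟨hv, -, hmono, -, he⟩ := heig
  obtain ⟨CF, hCF, hF⟩ := thmF hy
  obtain ⟨Ce, hCe, hE⟩ := err_bound hy
  obtain ⟨N, hN⟩ := e_mono hy (-CF)
  refine ⟨CF, ?_⟩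
  filter_upwards [eventually_ge_atTop N] with n hn
  set Vj : ℕ → ℝ := fun j => ∑ k : Fin (n + 1), ‖v k j‖ with hVj
  have hV0 : ∀ j, 0 ≤ Vj j := fun j => Finset.sum_nonneg fun _ _ => norm_nonneg _
  have hvb : ∀ k j, ‖v k j‖ ≤ 1 := fun k j => by
    have := lp.norm_apply_le_norm (by norm_num : (2 : ENNReal) ≠ 0) (v k) j
    rwa [hv.1 k] at this
  have hVsq : ∀ j, Vj j ^ 2 ≤ (n + 1) * ∑ k : Fin (n + 1), ‖v k j‖ ^ 2 := fun j => by
    have := sq_sum_le_card_mul_sum_sq (s := (Finset.univ : Finset (Fin (n + 1)))) (f := fun k => ‖v k j‖)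
    simpa using this
  have hS1 : Summable fun j : ℕ => br (j : ℤ) ^ (δ + 1) * Vj j ^ 2 := by
    have h1 : Summable fun j : ℕ => (n + 1) * ∑ k : Fin (n + 1), br (j : ℤ) ^ (δ + 1) * ‖v k j‖ ^ 2 := by
      refine Summable.mul_left _ (summable_sum fun k _ => ?_)
      exact decay' hy hs (v k) (lam k) (he k) 1 (hvb k)
    refine Summable.of_nonneg_of_le (fun j => by have := br_nat_pos j (δ + 1); positivity) (fun j => ?_) h1
    have := br_nat_pos j (δ + 1)
    calc _ ≤ br (j : ℤ) ^ (δ + 1) * ((n + 1) * ∑ k : Fin (n + 1), ‖v k j‖ ^ 2) := by gcongr; exact hVsq j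
      _ = _ := by rw [← Finset.mul_sum]; ring
  have hS2 : Summable fun j : ℕ => Vj j ^ 2 := by
    have h1 : Summable fun j : ℕ => (n + 1) * ∑ k : Fin (n + 1), ‖v k j‖ ^ 2 := by
      refine Summable.mul_left _ (summable_sum fun k _ => ?_)
      have := (lp.memℓp (v k)).summable (by norm_num)
      simpa using this
    exact Summable.of_nonneg_of_le (fun j => by positivity) hVsq h1
  set S := ∑' j : ℕ, br (j : ℤ) ^ (δ + 1) * Vj j ^ 2 with hS
  set L := ∑ k : Fin (n + 1), |lam k| with hL
  have hL0 : 0 ≤ L := Finset.sum_nonneg fun _ _ => abs_nonneg _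
  have hLk : ∀ k : Fin (n + 1), |lam k| ≤ L := fun k =>
    Finset.single_le_sum (f := fun k : Fin (n + 1) => |lam k|) (fun _ _ => abs_nonneg _) (Finset.mem_univ k)
  set T : ℕ → ℝ := fun M => ∑' j, Vj (j + M) ^ 2 with hT
  have hT0 : Tendsto T atTop (nhds 0) := tendsto_sum_nat_add fun j => Vj j ^ 2
  set e := d n - CF * br (n : ℤ) ^ (δ - κ) with hed
  have main : ∀ M : ℕ, n < M → e - |e| * T M - Ce * S * (1 / (M : ℝ)) - L * T M ≤ lam n := by
    intro M hM
    have hM0 : (0 : ℝ) < M := by exact_mod_cast (by omega : 0 < M)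
    obtain ⟨U, hU, h1, -⟩ := hF M (by omega)
    have hU' : U * U.conjTranspose = 1 := mul_eq_one_comm.1 hU
    let R : Matrix (Fin n) (Fin M) ℂ := Matrix.of fun i j => if (i : ℕ) = j then 1 else 0
    let V : Matrix (Fin M) (Fin (n + 1)) ℂ := Matrix.of fun j k => v k j
    obtain ⟨c, hc, hker⟩ := ker_vec' n (R * (U.conjTranspose * V))
    have hc1 : ∀ k, ‖c k‖ ≤ 1 := fun k => by
      have := Finset.single_le_sum (f := fun k => ‖c k‖ ^ 2) (fun _ _ => by positivity) (Finset.mem_univ k)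
      rw [hc] at this
      exact (sq_le_one_iff₀ (norm_nonneg _)).1 this
    set x : ℕ → ℂ := fun j => ∑ k : Fin (n + 1), c k * v k j with hxd
    have hxV : ∀ j, ‖x j‖ ≤ Vj j := fun j => by
      refine (norm_sum_le _ _).trans (Finset.sum_le_sum fun k _ => ?_)
      rw [norm_mul]
      exact mul_le_of_le_one_left (norm_nonneg _) (hc1 k)
    have hw : ∀ j, bandOp m d a x j = ∑ k : Fin (n + 1), (c k * lam k) * v k j := fun j => by
      rw [hxd, bandOp_sum]
      refine Finset.sum_congr rfl fun k _ => ?_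
      rw [he k j]; ring
    have hwV : ∀ j, ‖bandOp m d a x j‖ ≤ L * Vj j := fun j => by
      rw [hw, hVj, Finset.mul_sum]
      refine (norm_sum_le _ _).trans (Finset.sum_le_sum fun k _ => ?_)
      rw [norm_mul, norm_mul, Complex.norm_real, Real.norm_eq_abs]
      refine mul_le_mul_of_nonneg_right ?_ (norm_nonneg _)
      exact (mul_le_of_le_one_left (abs_nonneg _) (hc1 k)).trans (hLk k)
    -- inner products
    have hvo : Orthonormal ℂ (fun k : Fin (n + 1) => v k) := hv.comp _ Fin.val_injective
    set X : lp (fun _ : ℕ => ℂ) 2 := ∑ k : Fin (n + 1), c k • v k with hX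
    set Y : lp (fun _ : ℕ => ℂ) 2 := ∑ k : Fin (n + 1), (c k * lam k) • v k with hY
    have hXj : ∀ j, X j = x j := fun j => by
      rw [hX, lp.coeFn_sum, Finset.sum_apply]; rfl
    have hYj : ∀ j, Y j = bandOp m d a x j := fun j => by
      rw [hY, lp.coeFn_sum, Finset.sum_apply, hw]; rfl
    have iXX : inner ℂ X X = ((1 : ℝ) : ℂ) := by
      rw [hX, hvo.inner_sum, ← hc]
      push_cast
      refine Finset.sum_congr rfl fun k _ => Complex.conj_mul' _
    have iXY : inner ℂ X Y = ((∑ k : Fin (n + 1), lam k * ‖c k‖ ^ 2 : ℝ) : ℂ) := by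
      rw [hX, hY, hvo.inner_sum]
      push_cast
      refine Finset.sum_congr rfl fun k _ => ?_
      rw [← Complex.conj_mul']; ring
    have sXX : HasSum (fun j => star (x j) * x j) ((1 : ℝ) : ℂ) := by
      have := lp.hasSum_inner (𝕜 := ℂ) X X
      rw [iXX] at this
      refine this.congr_fun ?_
      intro j
      rw [RCLike.inner_apply, hXj, mul_comm]; rfl
    have sXY : HasSum (fun j => star (x j) * bandOp m d a x j)
        ((∑ k : Fin (n + 1), lam k * ‖c k‖ ^ 2 : ℝ) : ℂ) := by
      have := lp.hasSum_inner (𝕜 := ℂ) X Y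
      rw [iXY] at this
      refine this.congr_fun ?_
      intro j
      rw [RCLike.inner_apply, hXj, hYj, mul_comm]; rfl
    have t1 := tail_lem _ _ (fun j => Vj j ^ 2) sXX hS2 (fun j => by
      rw [norm_mul, norm_star, sq]
      exact mul_le_mul (hxV j) (hxV j) (norm_nonneg _) (hV0 j)) M
    have t2 := tail_lem _ _ (fun j => L * Vj j ^ 2) sXY (hS2.mul_left L) (fun j => by
      rw [norm_mul, norm_star]
      calc _ ≤ Vj j * (L * Vj j) := mul_le_mul (hxV j) (hwV j) (norm_nonneg _) (hV0 j)
        _ = _ := by ring) M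
    rw [tsum_mul_left] at t2
    have t2' := (abs_le.1 ((Complex.abs_re_le_norm _).trans t2)).1
    rw [Complex.sub_re, Complex.ofReal_re] at t2'
    set z : Fin M → ℂ := fun j => x j with hz
    set y := U.conjTranspose.mulVec z with hyd
    have hUy : U.mulVec y = z := by rw [hyd, Matrix.mulVec_mulVec, hU', Matrix.one_mulVec]
    have hsq : ∑ j ∈ Finset.range M, star (x j) * x j = ((∑ j, ‖y j‖ ^ 2 : ℝ) : ℂ) := by
      rw [← unit_norm U hU y, hUy, Finset.sum_range]
      push_cast
      refine Finset.sum_congr rfl fun k _ => Complex.conj_mul' _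
    rw [hsq, ← Complex.ofReal_sub, Complex.norm_real, Real.norm_eq_abs] at t1
    have hzV : V.mulVec c = z := by
      funext j
      simp only [V, hz, hxd, Matrix.mulVec, dotProduct, Matrix.of_apply]
      exact Finset.sum_congr rfl fun k _ => mul_comm _ _
    have hy0 : ∀ j : Fin M, (j : ℕ) < n → y j = 0 := fun j hj => by
      have := congrFun hker ⟨j, hj⟩
      rw [← Matrix.mulVec_mulVec, ← Matrix.mulVec_mulVec, hzV, ← hyd] at this
      simpa [R, Matrix.mulVec, dotProduct, Fin.val_inj] using this
    have herr := hE M (by omega) x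
    have hq := h1 y
    rw [hUy, qf_diag (fun j : Fin M => d j)] at hq
    have hwx : ∑ j ∈ Finset.range (M + m), br (j : ℤ) ^ (δ + 1) * ‖x j‖ ^ 2 ≤ S := by
      refine le_trans (Finset.sum_le_sum fun j _ => ?_)
        (hS1.sum_le_tsum (Finset.range (M + m)) fun j _ => by have := br_nat_pos j (δ + 1); positivity)
      have := br_nat_pos j (δ + 1)
      have := hxV j
      gcongr
    have herr2 : Ce / M * ∑ j ∈ Finset.range (M + m), br (j : ℤ) ^ (δ + 1) * ‖x j‖ ^ 2 ≤
        Ce * S * (1 / (M : ℝ)) := by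
      refine (mul_le_mul_of_nonneg_left hwx (by positivity)).trans (le_of_eq ?_)
      ring
    have hsum : e * ∑ j, ‖y j‖ ^ 2 ≤
        ∑ j : Fin M, d j * ‖y j‖ ^ 2 - CF * ∑ j : Fin M, br ((j : ℕ) : ℤ) ^ (δ - κ) * ‖y j‖ ^ 2 := by
      rw [Finset.mul_sum, Finset.mul_sum, ← Finset.sum_sub_distrib]
      refine Finset.sum_le_sum fun j _ => ?_
      by_cases hj : (j : ℕ) < n
      · rw [hy0 j hj]; simp
      · have h3 := hN n j hn (by omega)
        have : (0 : ℝ) ≤ ‖y j‖ ^ 2 := by positivity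
        rw [hed]
        nlinarith
    have hq' := (abs_le.1 ((Complex.abs_re_le_norm _).trans hq)).1
    have herr' := (abs_le.1 ((Complex.abs_re_le_norm _).trans herr)).1
    rw [Complex.sub_re] at hq' herr'
    rw [Complex.ofReal_re] at hq'
    have hlam : ∑ k : Fin (n + 1), lam k * ‖c k‖ ^ 2 ≤ lam n := by
      calc _ ≤ ∑ k : Fin (n + 1), lam n * ‖c k‖ ^ 2 := by
            refine Finset.sum_le_sum fun k _ => ?_
            have : lam k ≤ lam n := hmono (by omega)
            gcongr
        _ = lam n := by rw [← Finset.mul_sum, hc, mul_one]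
    have hee : e - |e| * T M ≤ e * ∑ j, ‖y j‖ ^ 2 := by
      have h5 : |e * (1 - ∑ j, ‖y j‖ ^ 2)| ≤ |e| * T M := by
        rw [abs_mul]; exact mul_le_mul_of_nonneg_left t1 (abs_nonneg _)
      have := (abs_le.1 h5).2
      linarith
    have hTT : L * ∑' j, Vj (j + M) ^ 2 = L * T M := rfl
    linarith
  have hlim : Tendsto (fun M : ℕ => e - |e| * T M - Ce * S * (1 / (M : ℝ)) - L * T M) atTop
      (nhds (e - |e| * 0 - Ce * S * 0 - L * 0)) :=
    ((tendsto_const_nhds.sub (hT0.const_mul _)).sub (tendsto_one_div_atTop_nhds_zero_nat.const_mul _)).sub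
      (hT0.const_mul _)
  simp only [mul_zero, sub_zero] at hlim
  exact le_of_tendsto hlim ((eventually_gt_atTop n).mono main)

end Part10

section Part11
lemma mk_Hy (m : ℕ) (d : ℕ → ℝ) (a : ℕ → ℕ → ℝ)
    (C δ κ : ℝ) (hC : 0 < C) (hκ : 0 < κ) (n₀ : ℕ)
    (hd : ∀ n : ℕ, n₀ ≤ n → C⁻¹ * (n : ℝ) ^ (δ + κ - 1) ≤ d (n + 1) - d n)
    (hd2 : (fun n : ℕ => d (n + 2) - 2 * d (n + 1) + d n)
      =O[atTop] fun n : ℕ => (n : ℝ) ^ (δ + κ - 2))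
    (ha : ∀ l ∈ Finset.Icc 1 m,
      (fun n : ℕ => a l n) =O[atTop] fun n : ℕ => (n : ℝ) ^ δ)
    (hΔa : ∀ l ∈ Finset.Icc 1 m,
      (fun n : ℕ => a l (n + 1) - a l n) =O[atTop] fun n : ℕ => (n : ℝ) ^ (δ - 1)) :
    ∃ n1 K c0, Hy m n1 d a δ κ K c0 := by
  obtain ⟨K0, hK0, h0⟩ := bigO_global _ _ hd2
  have h1 : ∀ l, ∃ K : ℝ, 0 < K ∧ (l ∈ Finset.Icc 1 m → ∀ n : ℕ, |a l n| ≤ K * br (n : ℤ) ^ δ) := fun l => by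
    by_cases hl : l ∈ Finset.Icc 1 m
    · obtain ⟨K, hK, h⟩ := bigO_global _ _ (ha l hl)
      exact ⟨K, hK, fun _ => h⟩
    · exact ⟨1, one_pos, fun h => absurd h hl⟩
  have h2 : ∀ l, ∃ K : ℝ, 0 < K ∧ (l ∈ Finset.Icc 1 m → ∀ n : ℕ, |a l (n + 1) - a l n| ≤ K * br (n : ℤ) ^ (δ - 1)) := fun l => by
    by_cases hl : l ∈ Finset.Icc 1 m
    · obtain ⟨K, hK, h⟩ := bigO_global _ _ (hΔa l hl)
      exact ⟨K, hK, fun _ => h⟩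
    · exact ⟨1, one_pos, fun h => absurd h hl⟩
  choose K1 hK1 h1 using h1
  choose K2 hK2 h2 using h2
  have s1 : 0 ≤ ∑ l ∈ Finset.Icc 1 m, K1 l := Finset.sum_nonneg fun l _ => (hK1 l).le
  have s2 : 0 ≤ ∑ l ∈ Finset.Icc 1 m, K2 l := Finset.sum_nonneg fun l _ => (hK2 l).le
  refine ⟨max n₀ 1, K0 + ∑ l ∈ Finset.Icc 1 m, K1 l + ∑ l ∈ Finset.Icc 1 m, K2 l,
    C⁻¹ * ((2 : ℝ) ^ |δ + κ - 1|)⁻¹, ?_⟩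
  refine ⟨by positivity, by positivity, hκ, fun l hl i => ?_, fun l hl i => ?_, fun i hi => ?_, fun i => ?_⟩
  · refine (h1 l hl i).trans (mul_le_mul_of_nonneg_right ?_ (br_nat_pos i _).le)
    have := Finset.single_le_sum (f := K1) (fun l _ => (hK1 l).le) hl
    linarith
  · refine (h2 l hl i).trans (mul_le_mul_of_nonneg_right ?_ (br_nat_pos i _).le)
    have := Finset.single_le_sum (f := K2) (fun l _ => (hK2 l).le) hl
    linarith
  · refine le_trans ?_ (hd i (by omega))
    have hi1 : (1 : ℝ) ≤ i := by exact_mod_cast (by omega : 1 ≤ i)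
    have h3 : br (i : ℤ) ^ (δ + κ - 1) ≤ (2 : ℝ) ^ |δ + κ - 1| * (i : ℝ) ^ (δ + κ - 1) := by
      apply slow_rpow _ _ _ _ (by linarith) (br_pos _) (by norm_num) <;> rw [br_nat] <;> linarith
    rw [mul_assoc]
    refine mul_le_mul_of_nonneg_left ?_ (by positivity)
    rw [inv_mul_le_iff₀ (by positivity)]
    exact h3
  · refine (h0 i).trans (mul_le_mul_of_nonneg_right ?_ (br_nat_pos i _).le)
    linarith

end Part11

/-- Theorem 5.2. If `C⁻¹n^{δ+κ−1} ≤ Δd(n) ≤ Cn^{δ+κ−1}`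
for `n ≥ n₀`, `Δ²d(n) = O(n^{δ+κ−2})`, `a_l(n) = O(n^δ)` and
`Δa_l(n) = O(n^{δ−1})` for `l = 1,…,m` (with `C > 0`, `κ > 0`, `δ + κ > 0`),
then `λ_n(A) = d(n) + O(n^{δ−κ})`. -/
theorem eigenvalue_asymptotics_power
    (m : ℕ) (d : ℕ → ℝ) (a : ℕ → ℕ → ℝ)
    (hsa : StandingAssumptions m d a)
    (lam : ℕ → ℝ) (v : ℕ → lp (fun _ : ℕ => ℂ) 2)
    (heig : IsEigenSystem m d a lam v)
    (C δ κ : ℝ) (hC : 0 < C) (hκ : 0 < κ) (hδκ : 0 < δ + κ) (n₀ : ℕ)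
    (hd : ∀ n : ℕ, n₀ ≤ n → C⁻¹ * (n : ℝ) ^ (δ + κ - 1) ≤ d (n + 1) - d n ∧
      d (n + 1) - d n ≤ C * (n : ℝ) ^ (δ + κ - 1))
    (hd2 : (fun n : ℕ => d (n + 2) - 2 * d (n + 1) + d n)
      =O[atTop] fun n : ℕ => (n : ℝ) ^ (δ + κ - 2))
    (ha : ∀ l ∈ Finset.Icc 1 m,
      (fun n : ℕ => a l n) =O[atTop] fun n : ℕ => (n : ℝ) ^ δ)
    (hΔa : ∀ l ∈ Finset.Icc 1 m,
      (fun n : ℕ => a l (n + 1) - a l n) =O[atTop] fun n : ℕ => (n : ℝ) ^ (δ - 1)) :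
    (fun n : ℕ => lam n - d n) =O[atTop] fun n : ℕ => (n : ℝ) ^ (δ - κ) := by
  obtain ⟨n1, K, c0, hy⟩ := mk_Hy m d a C δ κ hC hκ n₀ (fun n hn => (hd n hn).1) hd2 ha hΔa
  obtain ⟨C1, h1⟩ := upper hy hδκ lam v heig
  obtain ⟨C2, h2⟩ := lower hy hδκ lam v heig
  refine bigO_of_global _ _ (max C1 C2) ?_
  filter_upwards [h1, h2] with n h1 h2
  have hb := (br_nat_pos n (δ - κ)).le
  have e1 := mul_le_mul_of_nonneg_right (le_max_left C1 C2) hb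
  have e2 := mul_le_mul_of_nonneg_right (le_max_right C1 C2) hb
  rw [abs_le]
  constructor <;> linarith
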